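/- arXiv:2211.12919 — 13 statements merged into one kernel-verified Lean document; each statement's English description precedes it below -/
import Mathlib

section
/- Let G be a finite group, H ≤ G a subgroup, and x ∈ G. If y ∈ S_x (that is, y = h·x for some h ∈ H_x), then H_y = H_x and consequently S_y = S_x. Hence for any x, y ∈ G, the sets S_x and S_y are either equal or disjoint, so the sets S_x partition G. -/
/-- `Hx H x = ⋂_{i ∈ ℤ} x^i H x^{-i}`, described as the set of `g` with
`x^{-i} g x^i ∈ H` for all `i : ℤ`. -/
def Hx {G : Type*} [Group G] (H : Subgroup G) (x : G) : Set G :=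
  {g | ∀ i : ℤ, x ^ (-i) * g * x ^ i ∈ H}

/-- `Sx H x = Hx H x · x`. -/
def Sx {G : Type*} [Group G] (H : Subgroup G) (x : G) : Set G :=
  (fun h => h * x) '' Hx H x

/-- `Hx H x` as a subgroup of `G`. -/
def HxSubgroup {G : Type*} [Group G] (H : Subgroup G) (x : G) : Subgroup G where
  carrier := Hx H x
  one_mem' i := by simp [H.one_mem]
  mul_mem' {a b} ha hb i := by
    have h := H.mul_mem (ha i) (hb i)
    have e : x ^ (-i) * a * x ^ i * (x ^ (-i) * b * x ^ i) = x ^ (-i) * (a * b) * x ^ i := by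
      group
    rwa [e] at h
  inv_mem' {a} ha i := by
    have h := H.inv_mem (ha i)
    have e : (x ^ (-i) * a * x ^ i)⁻¹ = x ^ (-i) * a⁻¹ * x ^ i := by group
    rwa [e] at h

theorem mem_HxSubgroup {G : Type*} [Group G] {H : Subgroup G} {x g : G} :
    g ∈ HxSubgroup H x ↔ g ∈ Hx H x := Iff.rfl

theorem HxSubgroup_le {G : Type*} [Group G] (H : Subgroup G) (x : G) : HxSubgroup H x ≤ H := by
  intro g hg
  simpa using hg 0

theorem conj_zpow_mem_HxSubgroup {G : Type*} [Group G] {H : Subgroup G} {x g : G} (j : ℤ)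
    (hg : g ∈ HxSubgroup H x) : x ^ j * g * x ^ (-j) ∈ HxSubgroup H x := by
  intro i
  have h := hg (i - j)
  have e : x ^ (-(i - j)) * g * x ^ (i - j) = x ^ (-i) * (x ^ j * g * x ^ (-j)) * x ^ i := by
    group
  rwa [e] at h

theorem mem_normalizer_HxSubgroup {G : Type*} [Group G] (H : Subgroup G) (x : G) :
    x ∈ Subgroup.normalizer (HxSubgroup H x : Set G) := by
  rw [Subgroup.mem_normalizer_iff]
  intro g
  constructor
  · intro hg
    simpa using conj_zpow_mem_HxSubgroup 1 hg
  · intro hg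
    simpa [mul_assoc] using conj_zpow_mem_HxSubgroup (-1) hg

theorem le_HxSubgroup_of_mem_normalizer {G : Type*} [Group G] {H K : Subgroup G} {y : G}
    (hK : K ≤ H) (hy : y ∈ Subgroup.normalizer (K : Set G)) : K ≤ HxSubgroup H y := by
  intro g hg i
  have h := (Subgroup.mem_normalizer_iff.mp (zpow_mem hy (-i)) g).mp hg
  simpa using hK h

theorem HxSubgroup_le_HxSubgroup_mul {G : Type*} [Group G] {H : Subgroup G} {x h : G}
    (hh : h ∈ HxSubgroup H x) : HxSubgroup H x ≤ HxSubgroup H (h * x) :=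
  le_HxSubgroup_of_mem_normalizer (HxSubgroup_le H x)
    (mul_mem (Subgroup.le_normalizer hh) (mem_normalizer_HxSubgroup H x))

theorem HxSubgroup_mul {G : Type*} [Group G] {H : Subgroup G} {x h : G}
    (hh : h ∈ HxSubgroup H x) : HxSubgroup H (h * x) = HxSubgroup H x := by
  refine le_antisymm ?_ (HxSubgroup_le_HxSubgroup_mul hh)
  simpa using HxSubgroup_le_HxSubgroup_mul (inv_mem (HxSubgroup_le_HxSubgroup_mul hh hh))

theorem Hx_mul {G : Type*} [Group G] {H : Subgroup G} {x h : G} (hh : h ∈ Hx H x) :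
    Hx H (h * x) = Hx H x :=
  congrArg (fun K : Subgroup G => (K : Set G)) (HxSubgroup_mul (mem_HxSubgroup.mpr hh))

theorem Sx_mul {G : Type*} [Group G] {H : Subgroup G} {x h : G} (hh : h ∈ Hx H x) :
    Sx H (h * x) = Sx H x := by
  unfold Sx
  rw [Hx_mul hh]
  ext z
  constructor
  · rintro ⟨k, hk, rfl⟩
    exact ⟨k * h, (HxSubgroup H x).mul_mem hk hh, mul_assoc k h x⟩
  · rintro ⟨k, hk, rfl⟩
    exact ⟨k * h⁻¹, (HxSubgroup H x).mul_mem hk ((HxSubgroup H x).inv_mem hh), by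
      simp [mul_assoc]⟩

theorem Sx_eq_of_mem {G : Type*} [Group G] {H : Subgroup G} {x y : G} (hy : y ∈ Sx H x) :
    Sx H y = Sx H x := by
  obtain ⟨h, hh, rfl⟩ := hy
  exact Sx_mul hh

theorem stmt_0 {G : Type*} [Group G] [Finite G] (H : Subgroup G) :
    (∀ x y : G, y ∈ Sx H x → Hx H y = Hx H x ∧ Sx H y = Sx H x) ∧
    (∀ x y : G, Sx H x = Sx H y ∨ Sx H x ∩ Sx H y = ∅) ∧
    (∀ g : G, g ∈ Sx H g) := by
  refine ⟨?_, ?_, fun g => ⟨1, (HxSubgroup H g).one_mem, one_mul g⟩⟩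
  · intro x y hy
    refine ⟨?_, Sx_eq_of_mem hy⟩
    obtain ⟨h, hh, rfl⟩ := hy
    exact Hx_mul hh
  · intro x y
    rcases Set.eq_empty_or_nonempty (Sx H x ∩ Sx H y) with he | ⟨z, hzx, hzy⟩
    · exact Or.inr he
    · exact Or.inl ((Sx_eq_of_mem hzx).symm.trans (Sx_eq_of_mem hzy))
end

section
/- Let G be a finite group, H ≤ G a subgroup, x ∈ G and h ∈ H. If h S_x h^{-1} = S_x then h ∈ H_x. More generally, if h S_x h^{-1} ∩ S_x ≠ ∅ then h ∈ H_x. -/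
/-- If `h * a * x = b * x * h` with `a, b ∈ Hx H x`, then the conjugates of `h` by consecutive
powers of `x` lie in `H` simultaneously. -/
theorem zpow_conj_mem_iff_of_mul_eq {G : Type*} [Group G] {H : Subgroup G} {x h a b : G}
    (ha : a ∈ Hx H x) (hb : b ∈ Hx H x) (hab : h * a * x = b * x * h) (i : ℤ) :
    x ^ (-i) * h * x ^ i ∈ H ↔ x ^ (-(i + 1)) * h * x ^ (i + 1) ∈ H := by
  have hx : h = b * (x * h * x⁻¹) * a⁻¹ := by
    rw [eq_mul_inv_iff_mul_eq, ← mul_assoc, ← mul_assoc, ← hab, mul_inv_cancel_right]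
  have key : x ^ (-(i + 1)) * h * x ^ (i + 1) =
      (x ^ (-(i + 1)) * b * x ^ (i + 1)) * (x ^ (-i) * h * x ^ i) *
        (x ^ (-(i + 1)) * a * x ^ (i + 1))⁻¹ := by
    conv_lhs => rw [hx]
    group
  rw [key, H.mul_mem_cancel_right (H.inv_mem (ha (i + 1))), H.mul_mem_cancel_left (hb (i + 1))]

theorem mem_Hx_of_mul_eq {G : Type*} [Group G] {H : Subgroup G} {x h a b : G} (hh : h ∈ H)
    (ha : a ∈ Hx H x) (hb : b ∈ Hx H x) (hab : h * a * x = b * x * h) : h ∈ Hx H x := by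
  intro i
  induction i using Int.induction_on with
  | zero => simpa using hh
  | succ n ih => exact (zpow_conj_mem_iff_of_mul_eq ha hb hab n).1 ih
  | pred n ih =>
    refine (zpow_conj_mem_iff_of_mul_eq ha hb hab (-n - 1)).2 ?_
    rwa [sub_add_cancel]

theorem Sx_nonempty {G : Type*} [Group G] (H : Subgroup G) (x : G) : (Sx H x).Nonempty :=
  Set.Nonempty.image _ ⟨1, fun i => by simp [H.one_mem]⟩

theorem stmt_2 {G : Type*} [Group G] [Finite G] (H : Subgroup G) (x h : G) (hh : h ∈ H) :
    ((fun g => h * g * h⁻¹) '' Sx H x = Sx H x → h ∈ Hx H x) ∧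
    (((fun g => h * g * h⁻¹) '' Sx H x ∩ Sx H x).Nonempty → h ∈ Hx H x) := by
  have hmem : ((fun g => h * g * h⁻¹) '' Sx H x ∩ Sx H x).Nonempty → h ∈ Hx H x := by
    rintro ⟨_, ⟨_, ⟨a, ha, rfl⟩, rfl⟩, b, hb, hab⟩
    refine mem_Hx_of_mul_eq hh ha hb ?_
    rw [mul_assoc h a x]
    exact (eq_mul_inv_iff_mul_eq.1 hab).symm
  refine ⟨fun heq => hmem ?_, hmem⟩
  rw [heq, Set.inter_self]
  exact Sx_nonempty H x
end

section
/- Let G be a finite group, H ≤ G a subgroup, x ∈ G and h ∈ H_x. Then the centralizer of h·x in H equals the centralizer of h·x in H_x; that is, every a ∈ H with a(hx)a^{-1} = hx satisfies a ∈ H_x. -/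
theorem zpow_neg_mul_mul_zpow_mem {G : Type*} [Group G] {H : Subgroup G} {x h : G}
    (hh : h ∈ Hx H x) (i : ℤ) : x ^ (-i) * (h * x) ^ i ∈ H := by
  induction i using Int.induction_on with
  | zero => simp
  | succ n ih =>
    have e : x ^ (-((n : ℤ) + 1)) * (h * x) ^ ((n : ℤ) + 1) =
        (x ^ (-((n : ℤ) + 1)) * h * x ^ ((n : ℤ) + 1)) * (x ^ (-(n : ℤ)) * (h * x) ^ (n : ℤ)) := by
      rw [add_comm (n : ℤ) 1, zpow_one_add x, zpow_one_add (h * x), zpow_neg x n]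
      simp only [mul_assoc, mul_inv_cancel_left]
    rw [e]
    exact H.mul_mem (hh _) ih
  | pred n ih =>
    have e : x ^ (-(-(n : ℤ) - 1)) * (h * x) ^ (-(n : ℤ) - 1) =
        (x ^ (-(-(n : ℤ))) * h * x ^ (-(n : ℤ)))⁻¹ *
          (x ^ (-(-(n : ℤ))) * (h * x) ^ (-(n : ℤ))) := by
      rw [sub_eq_neg_add (-(n : ℤ)) 1, zpow_add (h * x)]
      group
    rw [e]
    exact H.mul_mem (H.inv_mem (hh _)) ih

theorem stmt_3 {G : Type*} [Group G] [Finite G] (H : Subgroup G) (x h : G)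
    (hh : h ∈ Hx H x) :
    {a : G | a ∈ H ∧ a * (h * x) * a⁻¹ = h * x} =
      {a : G | a ∈ Hx H x ∧ a * (h * x) * a⁻¹ = h * x} := by
  ext a
  refine and_congr_left fun hc => ⟨fun ha i => ?_, fun ha => by simpa using ha 0⟩
  have hcomm : a * (h * x) ^ i = (h * x) ^ i * a :=
    (Commute.zpow_right (show Commute a (h * x) from mul_inv_eq_iff_eq_mul.mp hc) i).eq
  have hk := zpow_neg_mul_mul_zpow_mem hh i
  have e : x ^ (-i) * a * x ^ i =
      (x ^ (-i) * (h * x) ^ i) * a * (x ^ (-i) * (h * x) ^ i)⁻¹ := by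
    rw [mul_assoc (x ^ (-i)) ((h * x) ^ i) a, ← hcomm]
    simp [mul_assoc]
  rw [e]
  exact H.mul_mem (H.mul_mem hk ha) (H.inv_mem hk)
end

section
/- Let K be an algebraically closed field of characteristic zero, G a finite group, N a normal subgroup of G, and g ∈ G an element whose image generates the (cyclic) quotient group G/N. Let W be a finite-dimensional irreducible K-representation of N. Then W is isomorphic as an N-representation to its g-conjugate g^*(W) (the representation on the same space in which n ∈ N acts as g n g^{-1} acts on W) if and only if the action of N on W can be extended to a representation of G on the same space, i.e. there exists a representation of G whose restriction to N equals W. -/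
/-- The elements `(x, u)` such that `φ` intertwines conjugation by `x` with conjugation by `u`. -/
def MonoidHom.conjIntertwiners {G U : Type*} [Group G] [Group U] {N : Subgroup G} [N.Normal]
    (φ : N →* U) : Subgroup (G × U) where
  carrier := {p | ∀ n : N, φ (MulAut.conjNormal p.1 n) = p.2 * φ n * p.2⁻¹}
  one_mem' n := by simp
  mul_mem' {p q} hp hq n := by
    change ∀ n : N, _ at hp hq
    simp [hp, hq, mul_assoc]
  inv_mem' {p} hp n := by
    have h := hp (MulAut.conjNormal p.1⁻¹ n)
    rw [← MulAut.mul_apply, ← map_mul, mul_inv_cancel, map_one, MulAut.one_apply] at h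
    simp [h, mul_assoc]

theorem MonoidHom.conjNormal_zpow {G U : Type*} [Group G] [Group U] {N : Subgroup G} [N.Normal]
    (φ : N →* U) {g : G} {u : U} (h : ∀ n : N, φ (MulAut.conjNormal g n) = u * φ n * u⁻¹)
    (k : ℤ) (n : N) : φ (MulAut.conjNormal (g ^ k) n) = u ^ k * φ n * (u ^ k)⁻¹ :=
  φ.conjIntertwiners.zpow_mem (x := (g, u)) h k n

/-- A homomorphism from a normal subgroup `N` extends to `G`, when `G ⧸ N` is generated by the
image of `g`, as soon as there is a compatible candidate `u` for the image of `g`. -/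
theorem MonoidHom.exists_extension_of_zpowers_eq_top {G U : Type*} [Group G] [Group U]
    {N : Subgroup G} [N.Normal] (φ : N →* U) {g : G}
    (hg : Subgroup.zpowers (g : G ⧸ N) = ⊤) {u : U}
    (h : ∀ n : N, φ (MulAut.conjNormal g n) = u * φ n * u⁻¹)
    (a : N) (ha : (a : G) = g ^ orderOf (g : G ⧸ N)) (hu : u ^ orderOf (g : G ⧸ N) = φ a) :
    ∃ ψ : G →* U, ∀ n : N, ψ n = φ n := by
  let α : Multiplicative ℤ →* MulAut N := zpowersHom _ (MulAut.conjNormal g)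
  let π : N ⋊[α] Multiplicative ℤ →* G := SemidirectProduct.lift N.subtype (zpowersHom _ g) (by
    intro k
    ext n
    simp [α, ← map_zpow, MulAut.conjNormal_apply])
  let χ : N ⋊[α] Multiplicative ℤ →* U := SemidirectProduct.lift φ (zpowersHom _ u) (by
    intro k
    ext n
    simp [α, ← map_zpow, φ.conjNormal_zpow h])
  have hπ : Function.Surjective π := by
    intro x
    obtain ⟨k, hk⟩ := Subgroup.mem_zpowers_iff.1 (hg ▸ Subgroup.mem_top (x : G ⧸ N))
    have hx : x * (g ^ k)⁻¹ ∈ N := by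
      rw [← QuotientGroup.eq_one_iff]
      simp [← hk]
    exact ⟨⟨⟨_, hx⟩, Multiplicative.ofAdd k⟩, by simp [π, SemidirectProduct.lift]⟩
  have hker : π.ker ≤ χ.ker := by
    rintro ⟨n, k⟩ hx
    obtain ⟨k, rfl⟩ := Multiplicative.ofAdd.surjective k
    have hn : (n : G) * g ^ k = 1 := by
      simpa [π, SemidirectProduct.lift, MonoidHom.mem_ker] using hx
    have hk : (g : G ⧸ N) ^ k = 1 := by
      have := congrArg (QuotientGroup.mk (s := N)) hn
      simpa [(QuotientGroup.eq_one_iff (n : G)).2 n.2] using this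
    obtain ⟨j, rfl⟩ := orderOf_dvd_iff_zpow_eq_one.2 hk
    rw [zpow_mul, zpow_natCast, ← ha] at hn
    have hn' : n * a ^ j = 1 := Subtype.ext (by simpa using hn)
    change φ n * u ^ ((orderOf (g : G ⧸ N) : ℤ) * j) = 1
    rw [zpow_mul, zpow_natCast, hu, ← map_zpow, ← map_mul, hn', map_one]
  refine ⟨π.liftOfSurjective hπ ⟨χ, hker⟩, fun n => ?_⟩
  have := π.liftOfRightInverse_comp_apply _ (Function.rightInverse_surjInv hπ) ⟨χ, hker⟩
    (SemidirectProduct.inl n)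
  simpa [π, χ] using this

theorem Representation.exists_eq_smul_one_of_commute {K H V : Type*} [Field K] [IsAlgClosed K]
    [Monoid H] [AddCommGroup V] [Module K V] [FiniteDimensional K V] [Nontrivial V]
    (ρ : Representation K H V)
    (hirr : ∀ U : Submodule K V, (∀ (n : H) (v : V), v ∈ U → ρ n v ∈ U) → U = ⊥ ∨ U = ⊤)
    (f : Module.End K V) (hf : ∀ n, Commute f (ρ n)) : ∃ c : K, f = c • 1 := by
  obtain ⟨c, hc⟩ := Module.End.exists_eigenvalue f
  refine ⟨c, ?_⟩
  have htop := (hirr (f.eigenspace c) fun n v hv => ?_).resolve_left hc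
  · ext v
    have : v ∈ f.eigenspace c := htop ▸ Submodule.mem_top
    simpa [Module.End.mem_eigenspace_iff] using this
  · rw [Module.End.mem_eigenspace_iff] at hv ⊢
    rw [← Module.End.mul_apply, (hf n).eq, Module.End.mul_apply, hv, map_smul]

theorem stmt_4 {K : Type*} [Field K] [IsAlgClosed K] [CharZero K]
    {G : Type*} [Group G] [Finite G] (N : Subgroup G) [N.Normal] (g : G)
    (hg : Subgroup.zpowers ((g : G ⧸ N)) = ⊤)
    {V : Type*} [AddCommGroup V] [Module K V] [FiniteDimensional K V] [Nontrivial V]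
    (ρ : Representation K N V)
    (hirr : ∀ U : Submodule K V, (∀ (n : N) (v : V), v ∈ U → ρ n v ∈ U) → U = ⊥ ∨ U = ⊤) :
    (∃ e : V ≃ₗ[K] V, ∀ (n : N) (v : V), e (ρ n v) = ρ (MulAut.conjNormal g n) (e v)) ↔
      (∃ σ : Representation K G V, ∀ n : N, σ (n : G) = ρ n) := by
  constructor
  · rintro ⟨e, he⟩
    set m := orderOf (g : G ⧸ N)
    have hm0 : m ≠ 0 := (orderOf_pos _).ne'
    have hgm : g ^ m ∈ N := by
      rw [← QuotientGroup.eq_one_iff, QuotientGroup.mk_pow, pow_orderOf_eq_one]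
    let φ : N →* (Module.End K V)ˣ := MonoidHom.toHomUnits ρ
    let u : (Module.End K V)ˣ := LinearMap.GeneralLinearGroup.ofLinearEquiv e
    have hu (n : N) : φ (MulAut.conjNormal g n) = u * φ n * u⁻¹ := by
      rw [eq_mul_inv_iff_mul_eq]
      ext v
      exact (he n v).symm
    let a : N := ⟨g ^ m, hgm⟩
    have hcomm (n : N) : Commute ((φ a)⁻¹ * u ^ m) (φ n) := by
      have h₁ := φ.conjNormal_zpow hu m n
      have h₂ : MulAut.conjNormal (g ^ (m : ℤ)) n = a * n * a⁻¹ := by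
        ext
        rw [MulAut.conjNormal_apply, zpow_natCast]
        rfl
      rw [h₂, map_mul, map_mul, map_inv, zpow_natCast, eq_mul_inv_iff_mul_eq] at h₁
      rw [Commute, SemiconjBy, mul_assoc, inv_mul_eq_iff_eq_mul, ← h₁]
      simp only [mul_assoc]
    obtain ⟨c, hc⟩ := ρ.exists_eq_smul_one_of_commute hirr
      (((φ a)⁻¹ * u ^ m : (Module.End K V)ˣ) : Module.End K V)
      fun n => congrArg Units.val (hcomm n).eq
    have hc0 : c ≠ 0 := by
      rintro rfl
      rw [zero_smul] at hc
      exact Units.ne_zero _ hc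
    obtain ⟨d, hd⟩ := IsAlgClosed.exists_pow_nat_eq c (Nat.pos_of_ne_zero hm0)
    have hd0 : d ≠ 0 := by
      rintro rfl
      exact hc0 (by rw [← hd, zero_pow hm0])
    let z : (Module.End K V)ˣ := Units.map (algebraMap K (Module.End K V)) (Units.mk0 d hd0)
    have hz (x : (Module.End K V)ˣ) : Commute z x :=
      Units.ext (Algebra.commutes d (x : Module.End K V))
    have hzm : z ^ m = (φ a)⁻¹ * u ^ m := by
      ext1
      rw [hc, ← hd, ← Algebra.algebraMap_eq_smul_one, map_pow]
      rfl
    obtain ⟨ψ, hψ⟩ := φ.exists_extension_of_zpowers_eq_top hg (u := u * z⁻¹)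
      (fun n => by
        rw [hu n, mul_assoc u z⁻¹, ((hz _).inv_left).eq]
        group)
      a rfl (by
        rw [((hz u).inv_left.symm).mul_pow, inv_pow, hzm, mul_inv_rev, inv_inv,
          mul_inv_cancel_left])
    exact ⟨(Units.coeHom _).comp ψ, fun n => congrArg Units.val (hψ n)⟩
  · rintro ⟨σ, hσ⟩
    refine ⟨LinearMap.GeneralLinearGroup.toLinearEquiv (MonoidHom.toHomUnits σ g), fun n v => ?_⟩
    change σ g (ρ n v) = ρ (MulAut.conjNormal g n) (σ g v)
    rw [← hσ, ← hσ, ← Module.End.mul_apply, ← Module.End.mul_apply, ← map_mul, ← map_mul,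
      MulAut.conjNormal_apply, inv_mul_cancel_right]
end

section
/- Let H be a finite group and ν : H → H a group automorphism. Then the number of orbits of the ν-twisted conjugation action of H on itself, given by h • k = h k ν(h)^{-1}, equals the number of isomorphism classes of irreducible finite-dimensional complex representations W of H such that the representation W∘ν (precomposition of the action with ν) is isomorphic to W. -/
open CategoryTheory

namespace FDRep

open Module Representation
open scoped MonoidAlgebra

universe u

variable {k G : Type u} [Field k] [IsAlgClosed k] [CharZero k] [Group G]

section ClassFunctions

variable [Fintype G]

theorem simple_of_isIrreducible {V : Type u} [AddCommGroup V] [Module k V]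
    [FiniteDimensional k V] (ρ : Representation k G V) [ρ.IsIrreducible] : Simple (of ρ) := by
  have : Invertible (Nat.card G : k) := invertibleOfNonzero (NeZero.ne _)
  have h := Representation.char_orthonormal ρ ρ
  rw [if_pos ⟨.refl ρ⟩, inv_mul_eq_one₀ (NeZero.ne _)] at h
  exact (simple_iff_char_is_norm_one _).2 h.symm

/-- On a simple representation, a class function orthogonal to the character acts as zero. -/
theorem sum_smul_ρ_eq_zero (V : FDRep k G) [Simple V] {f : G → k}
    (hf : ∀ g h, f (h * g * h⁻¹) = f g) (h0 : ∑ g, f g * V.character g⁻¹ = 0) :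
    ∑ g, f g • V.ρ g⁻¹ = 0 := by
  set a : V →ₗ[k] V := ∑ g, f g • V.ρ g⁻¹ with ha
  have hinv : a ∈ (linHom V.ρ V.ρ).invariants := by
    intro h
    rw [linHom_apply, ha]
    conv_rhs => rw [← Equiv.sum_comp (MulAut.conj h).toEquiv]
    have hf' : ∀ g h, f (h * (g * h⁻¹)) = f g := by simpa [mul_assoc] using hf
    ext v
    simp [hf', ← Module.End.mul_apply, ← map_mul, mul_assoc]
  have hfin : finrank k (linHom V.ρ V.ρ).invariants = 1 := by
    rw [(linHom.invariantsEquivFDRepHom V V).finrank_eq]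
    exact (simple_iff_end_is_rank_one V).1 inferInstance
  have hid : (LinearMap.id : V →ₗ[k] V) ∈ (linHom V.ρ V.ρ).invariants := by
    intro h
    ext v
    simp [← Module.End.mul_apply, ← map_mul]
  by_cases hs : (LinearMap.id : V →ₗ[k] V) = 0
  · rw [← LinearMap.id_comp a, hs, LinearMap.zero_comp]
  · obtain ⟨c, hc⟩ := (finrank_eq_one_iff_of_nonzero' (⟨_, hid⟩ : (linHom V.ρ V.ρ).invariants)
      (by simpa using hs)).1 hfin ⟨a, hinv⟩
    have hc' : c • LinearMap.id = a := congrArg Subtype.val hc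
    have htr : LinearMap.trace k V a = 0 := by
      rw [ha, ← h0]; simp [character]
    have : (finrank k V : k) ≠ 0 := by
      intro h
      have : Subsingleton V := finrank_zero_iff.1 (Nat.cast_eq_zero.1 h)
      exact hs (Subsingleton.elim _ _)
    rw [← hc', map_smul, LinearMap.trace_id, smul_eq_mul, mul_eq_zero, or_iff_left this] at htr
    rw [← hc', htr, zero_smul]

omit [IsAlgClosed k] [CharZero k] [Fintype G] in
theorem _root_.Representation.isIrreducible_ofModule' (M : Type*) [AddCommGroup M] [Module k M]
    [Module k[G] M] [IsScalarTower k k[G] M] [IsSimpleModule k[G] M] :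
    (ofModule' (k := k) (G := G) M).IsIrreducible := by
  rw [irreducible_iff_isSimpleModule_asModule]
  let e : (ofModule' (k := k) (G := G) M).asModule ≃ₗ[k[G]] M :=
    { (ofModule' (k := k) (G := G) M).asModuleEquiv with
      map_smul' := fun r x ↦ by
        refine ((ofModule' (k := k) (G := G) M).asModuleEquiv_map_smul r x).trans ?_
        simp [asAlgebraHom, ofModule']
        rfl }
  exact IsSimpleModule.congr e

/-- A class function orthogonal to every irreducible character is zero. -/
theorem eq_zero_of_forall_sum_mul_character_eq_zero {f : G → k}
    (hf : ∀ g h, f (h * g * h⁻¹) = f g)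
    (h0 : ∀ V : FDRep k G, Simple V → ∑ g, f g * V.character g⁻¹ = 0) : f = 0 := by
  set x : k[G] := ∑ g, MonoidAlgebra.single g⁻¹ (f g) with hx
  have key : x = 0 := by
    have hj := IsSemisimpleModule.jacobson_eq_bot k[G] k[G]
    rw [← Submodule.mem_bot k[G], ← hj, Module.jacobson, Submodule.mem_sInf]
    intro I hI
    have : IsSimpleModule k[G] (k[G] ⧸ I) := isSimpleModule_iff_isCoatom.2 hI
    have : (ofModule' (k := k) (G := G) (k[G] ⧸ I)).IsIrreducible := isIrreducible_ofModule' _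
    have : FiniteDimensional k (k[G] ⧸ I) := Module.Finite.trans k[G] _
    have hs := simple_of_isIrreducible (ofModule' (k := k) (G := G) (k[G] ⧸ I))
    have h1 := sum_smul_ρ_eq_zero (of (ofModule' (k := k) (G := G) (k[G] ⧸ I))) hf (h0 _ hs)
    have h2 := LinearMap.congr_fun h1 (Submodule.Quotient.mk 1 : k[G] ⧸ I)
    rw [← Submodule.Quotient.mk_eq_zero]
    refine Eq.trans ?_ h2
    simp [ofModule', hx, ← Submodule.Quotient.mk_smul]
    exact map_sum I.mkQ _ _
  ext g
  have := DFunLike.congr_fun (congrArg MonoidAlgebra.coeff key) g⁻¹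
  classical
  simpa [hx, Finsupp.single_apply] using this

end ClassFunctions

/-- Isomorphism of simple representations. -/
def simpleSetoid (k G : Type u) [Field k] [Group G] : Setoid {V : FDRep k G // Simple V} where
  r V W := Nonempty (V.1 ≅ W.1)
  iseqv := ⟨fun V ↦ ⟨.refl V.1⟩, fun ⟨i⟩ ↦ ⟨i.symm⟩, fun ⟨i⟩ ⟨j⟩ ↦ ⟨i.trans j⟩⟩

/-- Isomorphism classes of simple representations. -/
abbrev Irr (k G : Type u) [Field k] [Group G] := Quotient (simpleSetoid k G)

namespace Irr

/-- A representative of an isomorphism class of simple representations. -/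
noncomputable def rep (i : Irr k G) : FDRep k G := i.out.1

instance (i : Irr k G) : Simple i.rep := i.out.2

omit [IsAlgClosed k] [CharZero k] in
theorem nonempty_rep_iso_iff {i j : Irr k G} : Nonempty (i.rep ≅ j.rep) ↔ i = j :=
  Quotient.out_equiv_out (s := simpleSetoid k G)

omit [IsAlgClosed k] [CharZero k] in
theorem nonempty_rep_iso (V : {V : FDRep k G // Simple V}) :
    Nonempty (rep (Quotient.mk (simpleSetoid k G) V) ≅ V.1) :=
  Quotient.mk_out (s := simpleSetoid k G) V

theorem sum_character_mul_character [Fintype G] [DecidableEq (Irr k G)] (i j : Irr k G) :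
    ∑ g, i.rep.character g * j.rep.character g⁻¹ = if i = j then (Nat.card G : k) else 0 := by
  have : Invertible (Nat.card G : k) := invertibleOfNonzero (NeZero.ne _)
  have h := char_orthonormal i.rep j.rep
  rw [inv_mul_eq_iff_eq_mul₀ (NeZero.ne _)] at h
  rw [h]
  simp [nonempty_rep_iso_iff]

instance [Finite G] : Finite (Irr k G) := by
  classical
  have := Fintype.ofFinite G
  refine LinearIndependent.finite (R := k) (f := fun i : Irr k G ↦ i.rep.character) ?_
  rw [linearIndependent_iff']
  intro s c hc j hj
  have h : ∑ g, (∑ i ∈ s, c i • i.rep.character) g * j.rep.character g⁻¹ = 0 := by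
    rw [hc]
    simp
  simp only [Finset.sum_apply, Pi.smul_apply, Finset.sum_mul, smul_eq_mul, mul_assoc] at h
  rw [Finset.sum_comm] at h
  simpa [← Finset.mul_sum, sum_character_mul_character, hj, NeZero.ne] using h

/-- Column orthogonality of the character table. -/
theorem sum_character_mul_character_inv [Fintype G] [DecidableEq G] [Fintype (Irr k G)] (g h : G) :
    ∑ i : Irr k G, i.rep.character h * i.rep.character g⁻¹ =
      (Finset.univ.filter fun x : G ↦ x * h * x⁻¹ = g).card := by
  let F (h : G) : k := (∑ i : Irr k G, i.rep.character h * i.rep.character g⁻¹) -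
    ∑ x : G, if x * h * x⁻¹ = g then 1 else 0
  suffices F = 0 by
    have := congrFun this h
    simpa [F, sub_eq_zero] using this
  refine eq_zero_of_forall_sum_mul_character_eq_zero (fun h y ↦ ?_) fun V hV ↦ ?_
  · simp only [F, char_conj]
    congr 1
    conv_rhs => rw [← Equiv.sum_comp (Equiv.mulRight y)]
    simp [mul_assoc]
  · classical
    let j : Irr k G := Quotient.mk _ ⟨V, hV⟩
    obtain ⟨e⟩ := nonempty_rep_iso (⟨V, hV⟩ : {V : FDRep k G // Simple V})
    have he : V.character = j.rep.character := (char_iso e).symm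
    have h1 : ∑ h, (∑ i : Irr k G, i.rep.character h * i.rep.character g⁻¹) *
        j.rep.character h⁻¹ = Nat.card G * j.rep.character g⁻¹ := by
      simp_rw [Finset.sum_mul, mul_right_comm _ (character _ g⁻¹)]
      rw [Finset.sum_comm]
      simp [← Finset.sum_mul, sum_character_mul_character]
    have h2 : ∑ h, (∑ x : G, if x * h * x⁻¹ = g then (1 : k) else 0) * j.rep.character h⁻¹ =
        Nat.card G * j.rep.character g⁻¹ := by
      simp_rw [Finset.sum_mul]
      rw [Finset.sum_comm]
      have (x : G) : ∑ h, (if x * h * x⁻¹ = g then (1 : k) else 0) * j.rep.character h⁻¹ =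
          j.rep.character g⁻¹ := by
        have hx (h : G) : x * h * x⁻¹ = g ↔ h = x⁻¹ * g * x := by
          constructor <;> rintro rfl <;> group
        simp only [hx, ite_mul, one_mul, zero_mul, Finset.sum_ite_eq', Finset.mem_univ, if_true]
        rw [← char_conj _ g⁻¹ x⁻¹]
        congr 1
        group
      simp only [this, Finset.sum_const, Finset.card_univ, nsmul_eq_mul, Nat.card_eq_fintype_card]
    simp only [F, he, sub_mul, Finset.sum_sub_distrib, h1, h2, sub_self]

end Irr

/-- The pullback of a representation along an automorphism of the group. -/
noncomputable abbrev twist (ν : G ≃* G) (V : FDRep k G) : FDRep k G :=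
  of (V.ρ.comp ν.toMonoidHom)

omit [IsAlgClosed k] [CharZero k] in
theorem character_twist (ν : G ≃* G) (V : FDRep k G) (g : G) :
    (twist ν V).character g = V.character (ν g) := rfl

instance simple_twist [Finite G] (ν : G ≃* G) (V : FDRep k G) [Simple V] : Simple (twist ν V) := by
  have := Fintype.ofFinite G
  rw [simple_iff_char_is_norm_one, ← (simple_iff_char_is_norm_one V).1 inferInstance]
  conv_rhs => rw [← Equiv.sum_comp ν.toEquiv]
  simp [character_twist]

omit [IsAlgClosed k] [CharZero k] in
theorem nonempty_twist_iso_congr (ν : G ≃* G) {V W : FDRep k G} (i : V ≅ W) :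
    Nonempty (twist ν V ≅ V) ↔ Nonempty (twist ν W ≅ W) := by
  have key {V W : FDRep k G} (i : V ≅ W) : Nonempty (twist ν V ≅ twist ν W) :=
    ⟨Action.mkIso ((Action.forget _ _).mapIso i) fun g ↦ i.hom.comm (ν g)⟩
  obtain ⟨e⟩ := key i
  exact ⟨fun ⟨f⟩ ↦ ⟨e.symm ≪≫ f ≪≫ i⟩, fun ⟨f⟩ ↦ ⟨e ≪≫ f ≪≫ i.symm⟩⟩

end FDRep

namespace MulEquiv

variable {G : Type*} [Group G]

/-- The twisted conjugation action `h • k = h * k * (ν h)⁻¹` of a group on itself. -/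
@[reducible]
def twistedConjAction (ν : G ≃* G) : MulAction G G where
  smul h k := h * k * (ν h)⁻¹
  one_smul k := by change 1 * k * (ν 1)⁻¹ = k; simp
  mul_smul a b k := by
    change a * b * k * (ν (a * b))⁻¹ = a * (b * k * (ν b)⁻¹) * (ν a)⁻¹
    simp [mul_assoc]

/-- Burnside's lemma for the twisted conjugation action. -/
theorem sum_card_twisted_centralizer [Fintype G] [DecidableEq G] (ν : G ≃* G) :
    ∑ h : G, (Finset.univ.filter fun x : G ↦ x * ν h * x⁻¹ = h).card =
      Nat.card (Quot fun k k' : G ↦ ∃ h : G, h * k * (ν h)⁻¹ = k') * Nat.card G := by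
  classical
  let := ν.twistedConjAction
  have hq : Nat.card (Quot fun k k' : G ↦ ∃ h : G, h * k * (ν h)⁻¹ = k') =
      Nat.card (MulAction.orbitRel.Quotient G G) := by
    refine Nat.card_congr (Quot.congrRight fun a b ↦ ?_)
    exact ⟨fun h ↦ (MulAction.orbitRel G G).symm h, fun h ↦ (MulAction.orbitRel G G).symm h⟩
  have := Fintype.ofFinite (MulAction.orbitRel.Quotient G G)
  rw [hq, Nat.card_eq_fintype_card, Nat.card_eq_fintype_card,
    ← MulAction.sum_card_fixedBy_eq_card_orbits_mul_card_group G G]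
  refine Finset.sum_congr rfl fun h _ ↦ ?_
  rw [Fintype.card_subtype]
  congr 1
  ext x
  simp only [Finset.mem_filter, Finset.mem_univ, true_and, MulAction.mem_fixedBy]
  change _ ↔ h * x * (ν h)⁻¹ = x
  rw [mul_inv_eq_iff_eq_mul, mul_inv_eq_iff_eq_mul, eq_comm]

end MulEquiv

theorem stmt_5 {H : Type} [Group H] [Finite H] (ν : H ≃* H) :
    Nat.card (Quot fun k k' : H => ∃ h : H, h * k * (ν h)⁻¹ = k') =
      Nat.card (Quot fun V W : {V : FDRep ℂ H // Simple V ∧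
          Nonempty (FDRep.of ((FDRep.ρ V).comp ν.toMonoidHom) ≅ V)} =>
        Nonempty (V.1 ≅ W.1)) := by
  classical
  have := Fintype.ofFinite H
  have := Fintype.ofFinite (FDRep.Irr ℂ H)
  have hirr : Nat.card (Quot fun V W : {V : FDRep ℂ H // Simple V ∧
          Nonempty (FDRep.of ((FDRep.ρ V).comp ν.toMonoidHom) ≅ V)} =>
        Nonempty (V.1 ≅ W.1)) =
      Nat.card {i : FDRep.Irr ℂ H // Nonempty (FDRep.twist ν i.rep ≅ i.rep)} := by
    refine Nat.card_congr ⟨Quot.lift (fun V ↦ ⟨Quotient.mk _ ⟨V.1, V.2.1⟩, ?_⟩) ?_,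
      fun i ↦ Quot.mk _ ⟨i.1.rep, inferInstance, i.2⟩, ?_, ?_⟩
    · obtain ⟨e⟩ := FDRep.Irr.nonempty_rep_iso ⟨V.1, V.2.1⟩
      exact (FDRep.nonempty_twist_iso_congr ν e).2 V.2.2
    · exact fun V W h ↦ Subtype.ext (Quotient.sound h)
    · rintro ⟨V⟩
      exact Quot.sound (FDRep.Irr.nonempty_rep_iso ⟨V.1, V.2.1⟩)
    · exact fun i ↦ Subtype.ext (Quotient.out_eq _)
  have : Invertible (Nat.card H : ℂ) := invertibleOfNonzero (NeZero.ne _)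
  have hrow (i : FDRep.Irr ℂ H) : ∑ h, i.rep.character (ν h) * i.rep.character h⁻¹ =
      if Nonempty (FDRep.twist ν i.rep ≅ i.rep) then (Nat.card H : ℂ) else 0 := by
    have h := FDRep.char_orthonormal (FDRep.twist ν i.rep) i.rep
    rw [inv_mul_eq_iff_eq_mul₀ (NeZero.ne _)] at h
    simpa [FDRep.character_twist] using h
  have hsum := congrArg (Nat.cast (R := ℂ)) ν.sum_card_twisted_centralizer
  rw [Nat.cast_sum, Nat.cast_mul] at hsum
  rw [Finset.sum_congr rfl fun h _ ↦
    (FDRep.Irr.sum_character_mul_character_inv (k := ℂ) h (ν h)).symm] at hsum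
  rw [Finset.sum_comm] at hsum
  simp_rw [hrow] at hsum
  rw [hirr, Nat.card_eq_fintype_card (α := {i : FDRep.Irr ℂ H // _}), Fintype.card_subtype]
  rw [← Finset.sum_filter, Finset.sum_const, nsmul_eq_mul] at hsum
  exact_mod_cast (mul_right_cancel₀ (NeZero.ne _) hsum).symm
end

section
/- Let G be a group, ξ : G → G an automorphism, and k ≥ 1 an integer. Define the automorphism ν of G^k by ν(g_0, …, g_{k-1}) = (ξ(g_{k-1}), g_0, …, g_{k-2}). Then the multiplication map G^k → G, (g_0, …, g_{k-1}) ↦ g_{k-1} g_{k-2} ⋯ g_0, induces a bijection from the set of orbits of the ν-twisted conjugation action of G^k on itself (a • b = a b ν(a)^{-1}) onto the set of orbits of the ξ-twisted conjugation action of G on itself (a • b = a b ξ(a)^{-1}). -/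
/-- Shifted conjugation of `g` into `h` by a family `c` telescopes on the descending products. -/
theorem prod_reverse_ofFn_of_shift_conj {G : Type*} [Group G] {n : ℕ} (x : G)
    (c g h : Fin (n + 1) → G) (h0 : h 0 = c 0 * g 0 * x⁻¹)
    (hs : ∀ i : Fin n, h i.succ = c i.succ * g i.succ * (c i.castSucc)⁻¹) :
    (List.ofFn h).reverse.prod = c (Fin.last n) * (List.ofFn g).reverse.prod * x⁻¹ := by
  induction n with
  | zero => simpa using h0
  | succ n ih =>
    have := ih (fun i => c i.castSucc) (fun i => g i.castSucc) (fun i => h i.castSucc) h0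
      (fun i => hs i.castSucc)
    have hl := hs (Fin.last n)
    rw [Fin.succ_last] at hl
    rw [List.ofFn_succ' h, List.ofFn_succ' g]
    simp only [List.concat_eq_append, List.reverse_append, List.reverse_singleton,
      List.singleton_append, List.prod_cons, this, hl]
    group

theorem exists_shift_conj {G : Type*} [Group G] {n : ℕ} (x : G) (g h : Fin (n + 1) → G) :
    ∃ c : Fin (n + 1) → G, h 0 = c 0 * g 0 * x⁻¹ ∧
      ∀ i : Fin n, h i.succ = c i.succ * g i.succ * (c i.castSucc)⁻¹ := by
  refine ⟨fun i => Fin.induction (motive := fun _ => G) (h 0 * x * (g 0)⁻¹)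
    (fun i y => h i.succ * y * (g i.succ)⁻¹) i, ?_, fun i => ?_⟩
  · simp
  · simp [Fin.induction_succ]

theorem stmt_6 {G : Type*} [Group G] (ξ : G ≃* G) (k : ℕ) (hk : 1 ≤ k)
    (ν : (Fin k → G) → (Fin k → G))
    (hν : ∀ (g : Fin k → G) (i : Fin k), ν g i =
      if h : (i : ℕ) = 0 then ξ (g ⟨k - 1, by omega⟩)
      else g ⟨(i : ℕ) - 1, by have := i.isLt; omega⟩) :
    ∃ F : Quot (fun a b : Fin k → G => ∃ c, c * a * (ν c)⁻¹ = b) →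
        Quot (fun a b : G => ∃ c, c * a * (ξ c)⁻¹ = b),
      (∀ g : Fin k → G, F (Quot.mk _ g) = Quot.mk _ ((List.ofFn g).reverse.prod)) ∧
      Function.Bijective F := by
  obtain ⟨n, rfl⟩ : ∃ n, k = n + 1 := ⟨k - 1, by omega⟩
  have hν0 (c : Fin (n + 1) → G) : ν c 0 = ξ (c (Fin.last n)) := by
    rw [hν]; rfl
  have hνs (c : Fin (n + 1) → G) (i : Fin n) : ν c i.succ = c i.castSucc := by
    rw [hν]; rfl
  have descend (a b : Fin (n + 1) → G) (hab : ∃ c, c * a * (ν c)⁻¹ = b) :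
      ∃ d, d * (List.ofFn a).reverse.prod * (ξ d)⁻¹ = (List.ofFn b).reverse.prod := by
    obtain ⟨c, rfl⟩ := hab
    exact ⟨c (Fin.last n), (prod_reverse_ofFn_of_shift_conj _ c a _ (by simp [hν0])
      (by simp [hνs])).symm⟩
  have lift (a b : Fin (n + 1) → G)
      (hab : ∃ d, d * (List.ofFn a).reverse.prod * (ξ d)⁻¹ = (List.ofFn b).reverse.prod) :
      ∃ c, c * a * (ν c)⁻¹ = b := by
    obtain ⟨d, hd⟩ := hab
    obtain ⟨c, h0, hs⟩ := exists_shift_conj (ξ d) a b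
    have hc : c (Fin.last n) = d := by
      have := prod_reverse_ofFn_of_shift_conj (ξ d) c a b h0 hs
      rw [← hd] at this
      simpa using this.symm
    refine ⟨c, funext fun i => ?_⟩
    cases i using Fin.cases with
    | zero => simp [hν0, hc, h0]
    | succ i => simp [hνs, hs]
  have hsec (x : G) :
      (List.ofFn (Fin.cons x (fun _ => 1) : Fin (n + 1) → G)).reverse.prod = x := by
    simp [List.ofFn_succ]
  refine ⟨Quot.map (fun g => (List.ofFn g).reverse.prod) descend, fun _ => rfl,
    Function.bijective_iff_has_inverse.2
      ⟨Quot.map (fun x => Fin.cons x (fun _ => 1)) fun x y hxy => lift _ _ ?_, ?_, ?_⟩⟩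
  · simpa only [hsec] using hxy
  · rintro ⟨g⟩
    refine Quot.sound (lift _ _ ⟨1, ?_⟩)
    rw [hsec]
    simp
  · rintro ⟨x⟩
    exact congrArg (Quot.mk _) (hsec x)
end

section
/- Let n, m ≥ 1, let g = (σ_1, …, σ_m) ∈ S_n^m, and let H = {(τ, τ, …, τ) : τ ∈ S_n} be the diagonal copy of the symmetric group S_n in S_n^m. Let φ_g : F_m → S_n be the homomorphism with φ_g(z_i) = σ_i, and let F_m^0 be the kernel of the homomorphism υ : F_m → ℤ sending every generator to 1. Then ⋂_{j ∈ ℤ} g^j H g^{-j} = {(τ, …, τ) : τ ∈ C_{S_n}(φ_g(F_m^0))}, the diagonal copy of the centralizer in S_n of the image φ_g(F_m^0). -/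
/-- The homomorphism `υ : F_m → ℤ` sending every generator to `1`. -/
def upsilon (m : ℕ) : FreeGroup (Fin m) →* Multiplicative ℤ :=
  FreeGroup.lift fun _ => Multiplicative.ofAdd 1

/-- The diagonal embedding `S_n → S_n^m`. -/
def diagHom (n m : ℕ) : Equiv.Perm (Fin n) →* (Fin m → Equiv.Perm (Fin n)) where
  toFun τ := fun _ => τ
  map_one' := rfl
  map_mul' _ _ := rfl

/-- If each generator conjugates `ρ (j + 1)` to `ρ j`, then a word `w` conjugates
`ρ (j + υ w)` to `ρ j`. -/
theorem semiconjBy_lift_upsilon {G : Type*} [Group G] {m : ℕ} (g : Fin m → G) (ρ : ℤ → G)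
    (h : ∀ i j, SemiconjBy (g i) (ρ (j + 1)) (ρ j)) (w : FreeGroup (Fin m)) (j : ℤ) :
    SemiconjBy (FreeGroup.lift g w) (ρ (j + (upsilon m w).toAdd)) (ρ j) := by
  induction w using FreeGroup.induction_on generalizing j with
  | C1 => simp
  | of i => simpa [upsilon] using h i j
  | inv_of i _ =>
    have := (h i (j - 1)).inv_symm_left
    simpa [upsilon, sub_eq_add_neg] using this
  | mul x y hx hy =>
    have := (hx j).mul_left (hy (j + (upsilon m x).toAdd))
    simpa [add_assoc] using this

theorem stmt_9 (n m : ℕ) (hn : 1 ≤ n) (hm : 1 ≤ m) (g : Fin m → Equiv.Perm (Fin n)) :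
    (⋂ j : ℤ, (fun a => g ^ j * a * (g ^ j)⁻¹) '' Set.range (diagHom n m)) =
      ⇑(diagHom n m) '' (Subgroup.centralizer
        (⇑(FreeGroup.lift g) '' ((upsilon m).ker : Set (FreeGroup (Fin m)))) :
          Set (Equiv.Perm (Fin n))) := by
  have diag_iff (a : Fin m → Equiv.Perm (Fin n)) (j : ℤ) :
      a ∈ (fun a => g ^ j * a * (g ^ j)⁻¹) '' Set.range (diagHom n m) ↔
        ∃ ρ, ∀ i, g i ^ j * ρ * (g i ^ j)⁻¹ = a i := by
    simp only [Set.mem_image, Set.exists_range_iff, funext_iff]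
    rfl
  ext a
  simp only [Set.mem_iInter, diag_iff]
  constructor
  · intro h
    choose ρ hρ using h
    have ha (i : Fin m) : a i = ρ 0 := by simpa using (hρ 0 i).symm
    refine ⟨ρ 0, ?_, funext fun i => (ha i).symm⟩
    rw [SetLike.mem_coe, Subgroup.mem_centralizer_iff]
    rintro _ ⟨w, hw, rfl⟩
    have hstep (i : Fin m) (j : ℤ) : SemiconjBy (g i) (ρ (j + 1)) (ρ j) := by
      have hconj : g i ^ (j + 1) * ρ (j + 1) * (g i ^ (j + 1))⁻¹ =
          g i ^ j * ρ j * (g i ^ j)⁻¹ := (hρ (j + 1) i).trans (hρ j i).symm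
      apply mul_inv_eq_iff_eq_mul.mp
      apply mul_left_cancel (a := g i ^ j)
      apply mul_right_cancel (b := (g i ^ j)⁻¹)
      simpa only [zpow_add_one, mul_inv_rev, mul_assoc] using hconj
    have hw' : upsilon m w = 1 := hw
    simpa [hw'] using (semiconjBy_lift_upsilon g ρ hstep w 0).eq
  · rintro ⟨τ, hτ, rfl⟩ j
    let k : Fin m := ⟨0, hm⟩
    refine ⟨(g k ^ j)⁻¹ * τ * g k ^ j, fun i => ?_⟩
    have hker : FreeGroup.of i ^ j * (FreeGroup.of k ^ j)⁻¹ ∈ (upsilon m).ker := by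
      simp [MonoidHom.mem_ker, upsilon]
    have hcomm := Subgroup.mem_centralizer_iff.mp hτ _ ⟨_, hker, rfl⟩
    simp only [map_mul, map_inv, map_zpow, FreeGroup.lift_apply_of] at hcomm
    change g i ^ j * ((g k ^ j)⁻¹ * τ * g k ^ j) * (g i ^ j)⁻¹ = τ
    calc
      _ = (g i ^ j * (g k ^ j)⁻¹ * τ) * (g k ^ j * (g i ^ j)⁻¹) := by group
      _ = τ := by rw [hcomm]; group
end

section
/- Let n, m ≥ 1 and let φ, ψ : F_m → S_n be two group homomorphisms from the free group F_m = ⟨z_1, …, z_m⟩ to the symmetric group S_n. Then the restrictions of φ and ψ to F_m^0 are equal if and only if there exists μ ∈ S_n centralizing φ(F_m^0) such that φ(z_i) = ψ(z_i)·μ for every i = 1, …, m. -/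
theorem upsilon_of {m : ℕ} (i : Fin m) :
    upsilon m (FreeGroup.of i) = Multiplicative.ofAdd 1 := by
  simp [upsilon]

/-- The kernel of `upsilon m` lies in every normal subgroup containing all quotients of a generator
by a fixed generator. -/
theorem ker_upsilon_le {m : ℕ} (j : Fin m) (N : Subgroup (FreeGroup (Fin m))) [N.Normal]
    (h : ∀ i, FreeGroup.of i * (FreeGroup.of j)⁻¹ ∈ N) : (upsilon m).ker ≤ N := by
  have key : QuotientGroup.mk' N =
      (zpowersHom _ (QuotientGroup.mk' N (FreeGroup.of j))).comp (upsilon m) := by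
    ext i
    rw [MonoidHom.comp_apply, upsilon_of, zpowersHom_apply, toAdd_ofAdd, zpow_one,
      ← mul_inv_eq_one, ← map_inv, ← map_mul]
    exact (QuotientGroup.eq_one_iff _).2 (h i)
  intro w hw
  rw [← QuotientGroup.eq_one_iff, ← QuotientGroup.mk'_apply, key, MonoidHom.comp_apply,
    MonoidHom.mem_ker.1 hw, map_one]

/-- If `φ` and `ψ` differ on generators by an element centralizing `φ (ker υ)`, then they conjugate
`φ (ker υ)` in the same way. -/
theorem conj_eq_of_mem_centralizer {m : ℕ} {G : Type*} [Group G] {φ ψ : FreeGroup (Fin m) →* G}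
    {μ : G} (hμ : ∀ k ∈ (upsilon m).ker, φ k * μ = μ * φ k)
    (h : ∀ i, φ (FreeGroup.of i) = ψ (FreeGroup.of i) * μ) (g : FreeGroup (Fin m)) :
    ∀ k ∈ (upsilon m).ker, ψ g * φ k * (ψ g)⁻¹ = φ (g * k * g⁻¹) := by
  induction g using FreeGroup.induction_on with
  | C1 => simp
  | of i =>
    intro k hk
    simp only [map_mul, map_inv, h, mul_inv_rev]
    rw [mul_assoc _ μ, ← hμ k hk]
    group
  | inv_of i ih =>
    intro k hk
    have hk' := (upsilon m).normal_ker.conj_mem k hk (FreeGroup.of i)⁻¹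
    have := ih _ hk'
    rw [show FreeGroup.of i * ((FreeGroup.of i)⁻¹ * k * (FreeGroup.of i)⁻¹⁻¹) * (FreeGroup.of i)⁻¹
      = k by group] at this
    rw [← this, map_inv]
    group
  | mul x y hx hy =>
    intro k hk
    have := hx _ ((upsilon m).normal_ker.conj_mem k hk y)
    rw [← hy k hk] at this
    rw [show x * y * k * (x * y)⁻¹ = x * (y * k * y⁻¹) * x⁻¹ by group, ← this, map_mul]
    group

/-- The largest subgroup of the kernel of `υ` on which `φ` and `ψ` agree is normal as soon as `ψ`
conjugates `φ (ker υ)` as `φ` does. -/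
theorem normal_ker_inf_eqLocus {m : ℕ} {G : Type*} [Group G] {φ ψ : FreeGroup (Fin m) →* G}
    (h : ∀ g, ∀ k ∈ (upsilon m).ker, ψ g * φ k * (ψ g)⁻¹ = φ (g * k * g⁻¹)) :
    ((upsilon m).ker ⊓ φ.eqLocus ψ).Normal where
  conj_mem k hk g := by
    refine ⟨(upsilon m).normal_ker.conj_mem k hk.1 g, ?_⟩
    have hk₂ : φ k = ψ k := hk.2
    change φ (g * k * g⁻¹) = ψ (g * k * g⁻¹)
    rw [← h g k hk.1, hk₂, map_mul, map_mul, map_inv]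

theorem stmt_10 (n m : ℕ) (hn : 1 ≤ n) (hm : 1 ≤ m)
    (φ ψ : FreeGroup (Fin m) →* Equiv.Perm (Fin n)) :
    (∀ w ∈ (upsilon m).ker, φ w = ψ w) ↔
      ∃ μ ∈ Subgroup.centralizer (⇑φ '' ((upsilon m).ker : Set (FreeGroup (Fin m)))),
        ∀ i : Fin m, φ (FreeGroup.of i) = ψ (FreeGroup.of i) * μ := by
  let z : FreeGroup (Fin m) := FreeGroup.of ⟨0, hm⟩
  have hz (i : Fin m) : FreeGroup.of i * z⁻¹ ∈ (upsilon m).ker := by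
    rw [MonoidHom.mem_ker, map_mul, map_inv, upsilon_of, upsilon_of, mul_inv_cancel]
  constructor
  · intro h
    refine ⟨(ψ z)⁻¹ * φ z, ?_, fun i => ?_⟩
    · rw [Subgroup.mem_centralizer_iff]
      rintro _ ⟨k, hk, rfl⟩
      have hconj := h _ ((upsilon m).normal_ker.conj_mem k hk z)
      simp only [map_mul, map_inv] at hconj
      rw [← h k hk] at hconj
      calc φ k * ((ψ z)⁻¹ * φ z) = (ψ z)⁻¹ * (ψ z * φ k * (ψ z)⁻¹) * φ z := by group
        _ = (ψ z)⁻¹ * φ z * φ k := by rw [← hconj]; group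
    · have hi := h _ (hz i)
      rw [map_mul, map_mul, map_inv, map_inv, mul_inv_eq_iff_eq_mul] at hi
      rw [hi, mul_assoc]
  · rintro ⟨μ, hμ, h⟩ w hw
    rw [Subgroup.mem_centralizer_iff] at hμ
    have := normal_ker_inf_eqLocus
      (conj_eq_of_mem_centralizer (fun k hk => hμ _ ⟨k, hk, rfl⟩) h)
    refine (ker_upsilon_le ⟨0, hm⟩ ((upsilon m).ker ⊓ φ.eqLocus ψ) (fun i => ⟨hz i, ?_⟩) hw).2
    change φ (FreeGroup.of i * z⁻¹) = ψ (FreeGroup.of i * z⁻¹)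
    rw [map_mul, map_mul, map_inv, map_inv, h i, show φ z = ψ z * μ from h _]
    group
end

section
/- Let F ⊆ E be an extension of finite fields with |F| = q and [E : F] = n. Then there exists an element a ∈ E such that the family (a, a^q, a^{q^2}, …, a^{q^{n-1}}) is a basis of E as a vector space over F. -/
theorem stmt_12 {F E : Type*} [Field F] [Field E] [Fintype F] [Finite E] [Algebra F E] :
    ∃ a : E,
      LinearIndependent F
        (fun i : Fin (Module.finrank F E) => a ^ Fintype.card F ^ (i : ℕ)) ∧
      Submodule.span F
        (Set.range fun i : Fin (Module.finrank F E) => a ^ Fintype.card F ^ (i : ℕ)) = ⊤ := by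
  let b := IsGalois.normalBasis F E
  let e := Equiv.ofBijective _ (FiniteField.bijective_frobeniusAlgEquivOfAlgebraic_pow F E)
  have h : (fun i : Fin (Module.finrank F E) => b 1 ^ Fintype.card F ^ (i : ℕ)) =
      b.reindex e.symm := by
    funext i
    rw [Module.Basis.reindex_apply, Equiv.symm_symm, Equiv.ofBijective_apply,
      IsGalois.normalBasis_apply (FiniteField.frobeniusAlgEquivOfAlgebraic F E ^ (i : ℕ)),
      AlgEquiv.coe_pow, FiniteField.coe_frobeniusAlgEquivOfAlgebraic_iterate]
  refine ⟨b 1, ?_⟩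
  rw [h]
  exact ⟨(b.reindex e.symm).linearIndependent, (b.reindex e.symm).span_eq⟩
end

section
/- Let F be a finite field with q elements and let n ≥ 1. Then the number of orbits of cardinality exactly n of the cyclic rotation action of ℤ/nℤ on the set of functions {0,1,…,n-1} → F (where the generator acts by cyclically shifting the entries) equals the number of monic irreducible polynomials of degree n in F[X]. -/
/-- The cyclic rotation `(c·w)(j) = w(j - 1)` on words of length `n` over `F`. -/
def rot (F : Type*) (n : ℕ) (w : Fin n → F) : Fin n → F :=
  fun j => w ((finRotate n).symm j)

open Polynomial FiniteField

section CyclicGalois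

variable {F L : Type*} [Field F] [Field L] [Algebra F L] [FiniteDimensional F L] [IsGalois F L]
  {σ : Gal(L/F)}

/-- A normal basis identifies the rotation of words with a generator of a cyclic Galois group. -/
theorem exists_equiv_semiconj_rot (hσ : ∀ g, g ∈ Subgroup.zpowers σ) {n : ℕ}
    (hn : Module.finrank F L = n) :
    ∃ e : (Fin n → F) ≃ L, Function.Semiconj e (rot F n) σ := by
  have hcard : Nat.card Gal(L/F) = n := (IsGalois.card_aut_eq_finrank F L).trans hn
  have hord : orderOf σ = n := (orderOf_eq_card_of_forall_mem_zpowers hσ).trans hcard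
  have hbij : Function.Bijective fun i : Fin n ↦ σ ^ (i : ℕ) := by
    rw [Fintype.bijective_iff_injective_and_card, Fintype.card_fin, ← Nat.card_eq_fintype_card,
      hcard]
    refine ⟨fun i j h ↦ Fin.ext (pow_injOn_Iio_orderOf ?_ ?_ h), rfl⟩ <;> simp [hord]
  let b := (IsGalois.normalBasis F L).reindex (Equiv.ofBijective _ hbij).symm
  have hb (i : Fin n) : b i = (σ ^ (i : ℕ)) (IsGalois.normalBasis F L 1) := by
    simp only [b, Module.Basis.reindex_apply, Equiv.symm_symm, Equiv.ofBijective_apply]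
    exact IsGalois.normalBasis_apply _
  have hrot (i : Fin n) : b (finRotate n i) = σ (b i) := by
    rw [hb, hb, ← AlgEquiv.mul_apply, ← pow_succ']
    congr 1
    obtain _ | m := n
    · exact i.elim0
    · rw [coe_finRotate]
      split_ifs with h
      · rw [h, Fin.val_last, ← hord, pow_orderOf_eq_one, pow_zero]
      · rfl
  refine ⟨b.equivFun.symm.toEquiv, fun w ↦ ?_⟩
  simp only [LinearEquiv.coe_toEquiv, Module.Basis.equivFun_symm_apply, map_sum, map_smul, rot]
  rw [← Equiv.sum_comp (finRotate n)]
  simp only [hrot, Equiv.symm_apply_apply]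

theorem minpoly_eq_iff_exists_iterate (hσ : ∀ g, g ∈ Subgroup.zpowers σ) {x y : L} :
    minpoly F x = minpoly F y ↔ ∃ k : ℕ, σ^[k] x = y := by
  rw [eq_comm, Normal.minpoly_eq_iff_mem_orbit]
  constructor
  · rintro ⟨g, rfl⟩
    obtain ⟨k, rfl⟩ := mem_powers_iff_mem_zpowers.mpr (hσ g)
    exact ⟨k, by simp [← AlgEquiv.coe_pow]⟩
  · rintro ⟨k, rfl⟩
    exact ⟨σ ^ k, by simp [← AlgEquiv.coe_pow]⟩

theorem ncard_iterate_eq_natDegree_minpoly (hσ : ∀ g, g ∈ Subgroup.zpowers σ) (x : L) :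
    Set.ncard {y | ∃ k : ℕ, σ^[k] x = y} = (minpoly F x).natDegree := by
  have hx : IsIntegral F x := IsIntegral.of_finite F x
  have hset : {y | ∃ k : ℕ, σ^[k] x = y} = (minpoly F x).rootSet L := by
    ext y
    rw [Set.mem_ofPred_eq, ← minpoly_eq_iff_exists_iterate hσ,
      mem_rootSet_of_ne (minpoly.ne_zero hx)]
    exact ⟨fun h ↦ h ▸ minpoly.aeval F y,
      fun h ↦ minpoly.eq_of_irreducible_of_monic (minpoly.irreducible hx) h (minpoly.monic hx)⟩
  rw [hset, Set.ncard_eq_toFinset_card', Set.toFinset_card]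
  exact card_rootSet_eq_natDegree (IsGalois.separable F x) (IsGalois.splits F x)

end CyclicGalois

theorem exists_minpoly_eq_of_natDegree_eq_finrank {F L : Type*} [Field F] [Field L] [Algebra F L]
    [Finite L] {p : F[X]} (hm : p.Monic) (hi : Irreducible p)
    (hd : p.natDegree = Module.finrank F L) : ∃ x : L, minpoly F x = p := by
  have := Fact.mk hi
  obtain ⟨f⟩ := nonempty_algHom_of_finrank_dvd (F := F) (K := AdjoinRoot p) (L := L) <| by
    rw [← hd, (AdjoinRoot.powerBasis hi.ne_zero).finrank, AdjoinRoot.powerBasis_dim]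
  refine ⟨f (AdjoinRoot.root p), (minpoly.eq_of_irreducible_of_monic hi ?_ hm).symm⟩
  rw [aeval_algHom_apply, AdjoinRoot.aeval_eq, AdjoinRoot.mk_self, map_zero]

theorem stmt_13 {F : Type*} [Field F] [Fintype F] (n : ℕ) (hn : 1 ≤ n) :
    Nat.card (Quot fun w v : {w : Fin n → F //
        Set.ncard {v | ∃ k : ℕ, (rot F n)^[k] w = v} = n} =>
      ∃ k : ℕ, (rot F n)^[k] w.1 = v.1) =
    Nat.card {p : Polynomial F // p.Monic ∧ Irreducible p ∧ p.natDegree = n} := by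
  have : NeZero n := ⟨by lia⟩
  obtain ⟨p, _⟩ := CharP.exists F
  have : Fact p.Prime := ⟨CharP.char_is_prime F p⟩
  let L := Extension F p n
  let σ : Gal(L/F) := Extension.frob F p n
  have hσ (g : Gal(L/F)) : g ∈ Subgroup.zpowers σ := by
    obtain ⟨i, -, rfl⟩ := Extension.exists_frob_pow_eq F p n g
    exact Subgroup.npow_mem_zpowers _ i
  have hL : Module.finrank F L = n := finrank_extension F p n
  obtain ⟨e, he⟩ := exists_equiv_semiconj_rot hσ hL
  have horbit (w v : Fin n → F) :
      (∃ k : ℕ, (rot F n)^[k] w = v) ↔ minpoly F (e w) = minpoly F (e v) := by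
    simp_rw [minpoly_eq_iff_exists_iterate hσ, ← (he.iterate_right _).eq, e.apply_eq_iff_eq]
  have hdeg (w : Fin n → F) :
      Set.ncard {v | ∃ k : ℕ, (rot F n)^[k] w = v} = (minpoly F (e w)).natDegree := by
    rw [← ncard_iterate_eq_natDegree_minpoly hσ, ← Set.ncard_image_of_injective _ e.injective]
    congr 1
    ext y
    obtain ⟨v, rfl⟩ := e.surjective y
    simp [horbit, minpoly_eq_iff_exists_iterate hσ]
  have hint (x : L) : IsIntegral F x := IsIntegral.of_finite F x
  refine Nat.card_congr (Equiv.ofBijective (Quot.lift (fun w ↦ ⟨minpoly F (e w.1),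
    minpoly.monic (hint _), minpoly.irreducible (hint _), (hdeg w.1).symm.trans w.2⟩)
    fun w v h ↦ Subtype.ext ((horbit _ _).mp h)) ⟨?_, ?_⟩)
  · rintro ⟨w⟩ ⟨v⟩ h
    exact Quot.sound ((horbit _ _).mpr (congrArg Subtype.val h))
  · rintro ⟨f, hm, hi, hd⟩
    obtain ⟨x, rfl⟩ := exists_minpoly_eq_of_natDegree_eq_finrank hm hi (hd.trans hL.symm)
    refine ⟨Quot.mk _ ⟨e.symm x, ?_⟩, Subtype.ext ?_⟩
    · rw [hdeg, e.apply_symm_apply, hd]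
    · simp
end

section
/- Let A be a finitely generated abelian group and n ≥ 1. Then the number of subgroups of index n in A × ℤ equals Σ_{d ∣ n} d · a_d, where a_d denotes the number of subgroups of index d in A. -/
theorem Group.FG.finite_subgroup_index_eq {A : Type*} [CommGroup A] [Group.FG A] {d : ℕ}
    (hd : d ≠ 0) : Finite {K : Subgroup A // K.index = d} := by
  let N : Subgroup A := (powMonoidHom d).range
  have hN (K : {K : Subgroup A // K.index = d}) : N ≤ K.1 := by
    rintro _ ⟨a, rfl⟩
    have := K.1.pow_index_mem a
    rwa [K.2] at this
  have : Finite (A ⧸ N) := by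
    apply CommGroup.finite_of_fg_isMulTorsion
    intro x
    induction x using QuotientGroup.induction_on with
    | H a =>
      rw [isOfFinOrder_iff_pow_eq_one]
      exact ⟨d, Nat.pos_of_ne_zero hd, (QuotientGroup.eq_one_iff _).2 ⟨a, rfl⟩⟩
  refine Finite.of_injective
    (fun K : {K : Subgroup A // K.index = d} ↦ K.1.map (QuotientGroup.mk' N)) fun K L h ↦ ?_
  have h' := congrArg (Subgroup.comap (QuotientGroup.mk' N)) h
  simp only [Subgroup.comap_map_eq, QuotientGroup.ker_mk', sup_eq_left.2 (hN K),
    sup_eq_left.2 (hN L)] at h'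
  exact Subtype.ext h'

theorem Subgroup.index_comap_inl_mul_index_map_snd {A B : Type*} [CommGroup A] [CommGroup B]
    (H : Subgroup (A × B)) :
    (H.comap (MonoidHom.inl A B)).index * (H.map (MonoidHom.snd A B)).index = H.index := by
  have hker : (MonoidHom.inl A B).range = (MonoidHom.snd A B).ker := by
    ext ⟨a, b⟩
    simp [Subgroup.mem_prod, eq_comm]
  have hrange : (MonoidHom.snd A B).range = ⊤ :=
    MonoidHom.range_eq_top.2 Prod.snd_surjective
  rw [Subgroup.index_map, Subgroup.index_comap, hker, hrange, Subgroup.index_top, mul_one,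
    ← Subgroup.relIndex_sup_left, Subgroup.relIndex_mul_index le_sup_left]

theorem Int.index_zpowers_ofAdd (m : ℤ) :
    (Subgroup.zpowers (Multiplicative.ofAdd m)).index = m.natAbs :=
  Int.index_zmultiples m

theorem Subgroup.eq_zpowers_ofAdd_index (L : Subgroup (Multiplicative ℤ)) :
    L = Subgroup.zpowers (Multiplicative.ofAdd (L.index : ℤ)) := by
  obtain ⟨g, rfl⟩ := (Subgroup.isCyclic_iff_exists_zpowers_eq_top L).1 inferInstance
  obtain ⟨g, rfl⟩ := Multiplicative.ofAdd.surjective g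
  rw [Int.index_zpowers_ofAdd]
  rcases Int.natAbs_eq g with h | h
  · rw [← h]
  · conv_lhs => rw [h]
    rw [ofAdd_neg, Subgroup.zpowers_inv]

/-- The subgroup of `A × ℤ` generated by `K × 0` and `(a, m)`, where `a` is any lift of `x`. -/
def Subgroup.extendByInt {A : Type*} [CommGroup A] (K : Subgroup A) (x : A ⧸ K) (m : ℕ) :
    Subgroup (A × Multiplicative ℤ) :=
  (Subgroup.zpowers (x, Multiplicative.ofAdd (m : ℤ))).comap
    ((QuotientGroup.mk' K).prodMap (MonoidHom.id _))

namespace Subgroup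

variable {A : Type*} [CommGroup A]

theorem mem_extendByInt {K : Subgroup A} {x : A ⧸ K} {m : ℕ} {p : A × Multiplicative ℤ} :
    p ∈ K.extendByInt x m ↔
      ∃ k : ℤ, x ^ k = p.1 ∧ Multiplicative.ofAdd (m : ℤ) ^ k = p.2 := by
  simp [extendByInt, mem_zpowers_iff, Prod.ext_iff]

theorem ofAdd_natCast_zpow_inj {m : ℕ} (hm : m ≠ 0) {k l : ℤ}
    (h : Multiplicative.ofAdd (m : ℤ) ^ k = Multiplicative.ofAdd (m : ℤ) ^ l) : k = l := by
  rw [← Int.ofAdd_mul, ← Int.ofAdd_mul] at h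
  exact mul_left_cancel₀ (Int.natCast_ne_zero.2 hm) (Multiplicative.ofAdd.injective h)

theorem comap_inl_extendByInt (K : Subgroup A) (x : A ⧸ K) {m : ℕ} (hm : m ≠ 0) :
    (K.extendByInt x m).comap (MonoidHom.inl A _) = K := by
  ext a
  rw [mem_comap, mem_extendByInt]
  constructor
  · rintro ⟨k, hk, hk'⟩
    obtain rfl : k = 0 := ofAdd_natCast_zpow_inj hm (by simpa using hk')
    exact (QuotientGroup.eq_one_iff a).1 (by simpa using hk.symm)
  · intro ha
    exact ⟨0, by simpa using ((QuotientGroup.eq_one_iff a).2 ha).symm, by simp⟩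

theorem map_snd_extendByInt (K : Subgroup A) (x : A ⧸ K) (m : ℕ) :
    (K.extendByInt x m).map (MonoidHom.snd A _) = zpowers (Multiplicative.ofAdd (m : ℤ)) := by
  ext z
  simp only [mem_map, mem_extendByInt, mem_zpowers_iff]
  constructor
  · rintro ⟨p, ⟨k, -, hk⟩, rfl⟩
    exact ⟨k, hk⟩
  · rintro ⟨k, rfl⟩
    obtain ⟨a, ha⟩ := QuotientGroup.mk_surjective (x ^ k)
    exact ⟨(a, _), ⟨k, ha.symm, rfl⟩, rfl⟩

theorem index_extendByInt (K : Subgroup A) (x : A ⧸ K) {m : ℕ} (hm : m ≠ 0) :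
    (K.extendByInt x m).index = K.index * m := by
  rw [← index_comap_inl_mul_index_map_snd, comap_inl_extendByInt K x hm, map_snd_extendByInt,
    Int.index_zpowers_ofAdd, Int.natAbs_natCast]

theorem extendByInt_injective (K : Subgroup A) {m : ℕ} (hm : m ≠ 0) :
    Function.Injective fun x : A ⧸ K ↦ K.extendByInt x m := by
  intro x y h
  obtain ⟨a, rfl⟩ := QuotientGroup.mk_surjective x
  have ha : (a, Multiplicative.ofAdd (m : ℤ)) ∈ K.extendByInt a m :=
    mem_extendByInt.2 ⟨1, by simp, by simp⟩
  rw [show K.extendByInt a m = K.extendByInt y m from h] at ha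
  obtain ⟨k, hk, hk'⟩ := mem_extendByInt.1 ha
  obtain rfl : k = 1 := ofAdd_natCast_zpow_inj hm (by simpa using hk')
  simpa using hk.symm

theorem exists_extendByInt_eq (H : Subgroup (A × Multiplicative ℤ)) :
    ∃ x, (H.comap (MonoidHom.inl A _)).extendByInt x (H.map (MonoidHom.snd A _)).index = H := by
  set m := (H.map (MonoidHom.snd A _)).index
  have hmap : H.map (MonoidHom.snd A _) = zpowers (Multiplicative.ofAdd (m : ℤ)) :=
    eq_zpowers_ofAdd_index _
  obtain ⟨⟨a, z⟩, ha, rfl : z = _⟩ := hmap ▸ mem_zpowers (Multiplicative.ofAdd (m : ℤ))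
  refine ⟨(a : A ⧸ _), ?_⟩
  have key (b : A) (k : ℤ) : (a : A ⧸ H.comap (MonoidHom.inl A _)) ^ k = b ↔
      (b, Multiplicative.ofAdd (m : ℤ) ^ k) ∈ H := by
    rw [← QuotientGroup.mk_zpow, QuotientGroup.eq, mem_comap,
      ← H.mul_mem_cancel_left (H.zpow_mem ha k) (y := MonoidHom.inl A _ _)]
    simp
  ext ⟨b, z⟩
  rw [mem_extendByInt]
  constructor
  · rintro ⟨k, hk, rfl⟩
    exact (key b k).1 hk
  · intro hb
    have hz := mem_map_of_mem (MonoidHom.snd A _) hb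
    rw [hmap] at hz
    obtain ⟨k, rfl : _ = z⟩ := mem_zpowers_iff.1 hz
    exact ⟨k, (key b k).2 hb, rfl⟩

end Subgroup

theorem stmt_14 {A : Type*} [CommGroup A] [Group.FG A] (n : ℕ) (hn : 1 ≤ n) :
    Nat.card {H : Subgroup (A × Multiplicative ℤ) // H.index = n} =
      ∑ d ∈ n.divisors, d * Nat.card {H : Subgroup A // H.index = d} := by
  have hdvd (d : n.divisors) : d.1 ∣ n := Nat.dvd_of_mem_divisors d.2
  have hd (d : n.divisors) : d.1 ≠ 0 := (Nat.pos_of_mem_divisors d.2).ne'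
  have hm (d : n.divisors) : n / d.1 ≠ 0 :=
    (Nat.div_pos (Nat.le_of_dvd hn (hdvd d)) (Nat.pos_of_mem_divisors d.2)).ne'
  let Φ : (Σ d : n.divisors, Σ K : {K : Subgroup A // K.index = d}, A ⧸ K.1) →
      {H : Subgroup (A × Multiplicative ℤ) // H.index = n} := fun p ↦
    ⟨p.2.1.1.extendByInt p.2.2 (n / p.1), by
      rw [Subgroup.index_extendByInt _ _ (hm p.1), p.2.1.2, Nat.mul_div_cancel' (hdvd p.1)]⟩
  have hΦ : Function.Bijective Φ := by
    constructor
    · rintro ⟨⟨d, hd⟩, ⟨K, hK⟩, x⟩ ⟨⟨d', hd'⟩, ⟨K', hK'⟩, x'⟩ h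
      have h : K.extendByInt x (n / d) = K'.extendByInt x' (n / d') := congrArg Subtype.val h
      obtain rfl : K = K' := by
        rw [← K.comap_inl_extendByInt x (hm ⟨d, hd⟩), h,
          K'.comap_inl_extendByInt x' (hm ⟨d', hd'⟩)]
      obtain rfl : d = d' := hK.symm.trans hK'
      obtain rfl : x = x' := K.extendByInt_injective (hm ⟨d, hd⟩) h
      rfl
    · rintro ⟨H, hH⟩
      obtain ⟨x, hx⟩ := H.exists_extendByInt_eq
      have hmul := H.index_comap_inl_mul_index_map_snd.trans hH
      have hpos : 0 < (H.comap (MonoidHom.inl A _)).index :=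
        Nat.pos_of_ne_zero fun h ↦ by simp [h] at hmul; omega
      refine ⟨⟨⟨_, Nat.mem_divisors.2 ⟨⟨_, hmul.symm⟩, by omega⟩⟩, ⟨_, rfl⟩, x⟩,
        Subtype.ext ?_⟩
      change Subgroup.extendByInt _ x (n / _) = H
      rw [Nat.div_eq_of_eq_mul_right hpos hmul.symm, hx]
  have (d : n.divisors) : Finite {K : Subgroup A // K.index = d} :=
    Group.FG.finite_subgroup_index_eq (hd d)
  have (d : n.divisors) (K : {K : Subgroup A // K.index = d}) : Finite (A ⧸ K.1) :=
    Nat.finite_of_card_ne_zero (K.2.symm ▸ hd d : K.1.index ≠ 0)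
  rw [← Nat.card_congr (Equiv.ofBijective Φ hΦ), Nat.card_sigma,
    ← Finset.sum_coe_sort n.divisors]
  refine Finset.sum_congr rfl fun d _ ↦ ?_
  have := Fintype.ofFinite {K : Subgroup A // K.index = d}
  rw [Nat.card_sigma, Finset.sum_congr rfl fun K _ ↦ (K.2 : Nat.card (A ⧸ K.1) = d)]
  simp [mul_comm]
end

section
/- Let G = ⟨a, b ∣ a b a^{-1} = b^{-1}⟩ be the fundamental group of the Klein bottle (the group presented by two generators a, b and the single relation a b a^{-1} b = 1). For d ≥ 1 define a_d = 1 if d is odd, a_d = (d+6)/4 if d ≡ 2 (mod 4), and a_d = (d+4)/4 if d ≡ 0 (mod 4). Then for every n ≥ 1, the number of conjugacy classes of subgroups of index n in G equals Σ_{d ∣ n} a_d. -/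
/-- The single relator `a b a⁻¹ b` of the Klein bottle group (with `a` the generator
indexed by `0` and `b` the generator indexed by `1`). -/
def kleinRels : Set (FreeGroup (Fin 2)) :=
  {FreeGroup.of 0 * FreeGroup.of 1 * (FreeGroup.of 0)⁻¹ * FreeGroup.of 1}

/-- `a_d = 1` if `d` is odd, `(d+6)/4` if `d ≡ 2 (mod 4)` and `(d+4)/4` if `d ≡ 0 (mod 4)`. -/
def kleinA (d : ℕ) : ℕ :=
  if d % 2 = 1 then 1 else if d % 4 = 2 then (d + 6) / 4 else (d + 4) / 4

/-- The sign `(-1) ^ x` as an integer. -/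
def intSign (x : ℤ) : ℤ := (x.negOnePow : ℤ)

lemma intSign_add (x y : ℤ) : intSign (x + y) = intSign x * intSign y := by
  simp [intSign, Int.negOnePow_add]

lemma intSign_zero : intSign 0 = 1 := by simp [intSign]

lemma intSign_one : intSign 1 = -1 := by simp [intSign]

lemma intSign_neg (x : ℤ) : intSign (-x) = intSign x := by simp [intSign, Int.negOnePow_neg]

lemma intSign_mul_self (x : ℤ) : intSign x * intSign x = 1 := by
  rw [← intSign_add, intSign, Int.negOnePow_even _ ⟨x, rfl⟩]; rfl

lemma intSign_of_even {x : ℤ} (h : Even x) : intSign x = 1 := by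
  simp [intSign, Int.negOnePow_even _ h]

lemma intSign_of_odd {x : ℤ} (h : Odd x) : intSign x = -1 := by
  simp [intSign, Int.negOnePow_odd _ h]

/-- The semidirect product `ℤ ⋊ ℤ` with the sign action; `⟨x, y⟩` stands for `b ^ y * a ^ x`. -/
@[ext]
structure Klein where
  /-- the exponent of `a` -/
  x : ℤ
  /-- the exponent of `b` -/
  y : ℤ

namespace Klein

instance : Mul Klein := ⟨fun p q => ⟨p.x + q.x, p.y + intSign p.x * q.y⟩⟩

instance : One Klein := ⟨⟨0, 0⟩⟩

instance : Inv Klein := ⟨fun p => ⟨-p.x, -(intSign p.x * p.y)⟩⟩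

@[simp] lemma mul_x (p q : Klein) : (p * q).x = p.x + q.x := rfl

@[simp] lemma mul_y (p q : Klein) : (p * q).y = p.y + intSign p.x * q.y := rfl

@[simp] lemma one_x : (1 : Klein).x = 0 := rfl

@[simp] lemma one_y : (1 : Klein).y = 0 := rfl

@[simp] lemma inv_x (p : Klein) : p⁻¹.x = -p.x := rfl

@[simp] lemma inv_y (p : Klein) : p⁻¹.y = -(intSign p.x * p.y) := rfl

instance : Group Klein :=
  Group.ofLeftAxioms
    (fun p q r => by
      ext
      · simp [add_assoc]
      · simp [intSign_add]; ring)
    (fun p => by ext <;> simp [intSign_zero])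
    (fun p => by
      ext
      · simp
      · simp [intSign_neg])

/-- The homomorphism `b ^ y * a ^ x ↦ x`. -/
def xHom : Klein →* Multiplicative ℤ where
  toFun p := Multiplicative.ofAdd p.x
  map_one' := rfl
  map_mul' _ _ := rfl

@[simp] lemma zpow_x (p : Klein) (j : ℤ) : (p ^ j).x = j * p.x := by
  have h := congrArg Multiplicative.toAdd (map_zpow xHom p j)
  simpa [xHom] using h

/-- The homomorphism `y ↦ b ^ y`. -/
def yHom : Multiplicative ℤ →* Klein where
  toFun y := ⟨0, y.toAdd⟩
  map_one' := rfl
  map_mul' _ _ := by ext <;> simp [intSign_zero]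

lemma mk_zero_zpow (y j : ℤ) : (⟨0, y⟩ : Klein) ^ j = ⟨0, j * y⟩ := by
  have h := map_zpow yHom (Multiplicative.ofAdd y) j
  simpa [yHom] using h.symm

/-- The homomorphism `x ↦ a ^ x`. -/
def aHom : Multiplicative ℤ →* Klein where
  toFun x := ⟨x.toAdd, 0⟩
  map_one' := rfl
  map_mul' _ _ := by ext <;> simp

lemma mk_zpow_zero (x j : ℤ) : (⟨x, 0⟩ : Klein) ^ j = ⟨j * x, 0⟩ := by
  have h := map_zpow aHom (Multiplicative.ofAdd x) j
  simpa [aHom] using h.symm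

/-- The homomorphism from the Klein bottle group to its model. -/
def ofPresented : PresentedGroup kleinRels →* Klein :=
  PresentedGroup.toGroup (f := ![⟨1, 0⟩, ⟨0, 1⟩]) (by
    rintro r rfl
    ext <;> simp [intSign_one, intSign_zero])

lemma presented_semiconj :
    SemiconjBy (PresentedGroup.of (rels := kleinRels) 0) (PresentedGroup.of 1)
      (PresentedGroup.of 1)⁻¹ := by
  have h : PresentedGroup.of (rels := kleinRels) 0 * PresentedGroup.of 1 *
      (PresentedGroup.of 0)⁻¹ * PresentedGroup.of 1 = 1 :=
    PresentedGroup.one_of_mem (rels := kleinRels) rfl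
  rw [SemiconjBy, eq_inv_mul_iff_mul_eq]
  have h2 := mul_eq_one_iff_eq_inv.1 h
  rw [mul_inv_eq_iff_eq_mul] at h2
  rw [h2]; group

lemma semiconj_zpow {G : Type*} [Group G] {a b : G} (h : SemiconjBy a b b⁻¹) (x y : ℤ) :
    SemiconjBy (a ^ x) (b ^ y) (b ^ (intSign x * y)) := by
  have h1 (y : ℤ) : SemiconjBy a (b ^ y) (b ^ (-y)) := by
    simpa using h.zpow_right y
  have h2 (y : ℤ) : SemiconjBy a⁻¹ (b ^ y) (b ^ (-y)) := by
    rw [SemiconjBy.inv_symm_left_iff]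
    simpa using h1 (-y)
  induction x with
  | zero => simp [intSign_zero]
  | succ i ih =>
    rw [add_comm, zpow_add, zpow_one, intSign_add, intSign_one]
    have := (h1 (intSign i * y)).mul_left ih
    simpa using this
  | pred i ih =>
    rw [sub_eq_neg_add, zpow_add, zpow_neg_one, intSign_add, intSign_neg, intSign_one]
    have := (h2 (intSign (-i) * y)).mul_left ih
    simpa using this

/-- The homomorphism from the model to the Klein bottle group. -/
def toPresented : Klein →* PresentedGroup kleinRels where
  toFun p := PresentedGroup.of 1 ^ p.y * PresentedGroup.of 0 ^ p.x
  map_one' := by simp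
  map_mul' p q := by
    have h := semiconj_zpow presented_semiconj p.x q.y
    rw [SemiconjBy] at h
    simp only [mul_x, mul_y, zpow_add]
    rw [mul_assoc, ← mul_assoc _ _ (_ ^ q.x), ← h]
    group

/-- The Klein bottle group is isomorphic to its model. -/
def presentedEquiv : PresentedGroup kleinRels ≃* Klein :=
  MonoidHom.toMulEquiv ofPresented toPresented
    (by
      apply PresentedGroup.ext
      intro i
      fin_cases i <;> simp [ofPresented, toPresented])
    (by
      refine MonoidHom.ext fun p => ?_
      simp [ofPresented, toPresented, mk_zero_zpow, mk_zpow_zero]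
      ext <;> simp [intSign_zero])

/-- `H` meets `⟨b⟩` in `⟨b ^ m⟩`, has `a`-exponents divisible by `k` and contains
`b ^ s * a ^ k`. -/
structure HasType (H : Subgroup Klein) (k m : ℕ) (s : ℤ) : Prop where
  mem_iff (y : ℤ) : (⟨0, y⟩ : Klein) ∈ H ↔ (m : ℤ) ∣ y
  dvd_x (p : Klein) (hp : p ∈ H) : (k : ℤ) ∣ p.x
  gen_mem : (⟨k, s⟩ : Klein) ∈ H

namespace HasType

variable {H H' : Subgroup Klein} {k m k' m' : ℕ} {s s' : ℤ}

lemma le (h : HasType H k m s) (h' : HasType H' k m s) : H ≤ H' := by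
  intro p hp
  obtain ⟨j, hj⟩ := h.dvd_x p hp
  set g : Klein := ⟨k, s⟩ with hg
  have hq : p * (g ^ j)⁻¹ = ⟨0, (p * (g ^ j)⁻¹).y⟩ := by
    ext
    · simp [hg, hj]; ring
    · rfl
  have h1 : p * (g ^ j)⁻¹ ∈ H := H.mul_mem hp (H.inv_mem (H.zpow_mem h.gen_mem j))
  rw [hq, h.mem_iff, ← h'.mem_iff, ← hq] at h1
  simpa [hg] using H'.mul_mem h1 (H'.zpow_mem h'.gen_mem j)

lemma eq (h : HasType H k m s) (h' : HasType H' k m s) : H = H' :=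
  le_antisymm (h.le h') (h'.le h)

lemma congr_mod (h : HasType H k m s) (hs : (m : ℤ) ∣ s' - s) : HasType H k m s' where
  mem_iff := h.mem_iff
  dvd_x := h.dvd_x
  gen_mem := by
    have h1 := H.mul_mem ((h.mem_iff _).2 hs) h.gen_mem
    convert h1 using 1
    ext <;> simp [intSign_zero]

lemma dvd_sub (h : HasType H k m s) (h' : HasType H k m s') : (m : ℤ) ∣ s' - s := by
  rw [← h.mem_iff]
  convert H.mul_mem h'.gen_mem (H.inv_mem h.gen_mem) using 1
  ext
  · simp
  · simp [← mul_assoc, intSign_mul_self, sub_eq_add_neg]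

lemma unique (h : HasType H k m s) (h' : HasType H k' m' s') : k = k' ∧ m = m' := by
  constructor
  · exact Nat.dvd_antisymm (Int.natCast_dvd_natCast.1 (h.dvd_x _ h'.gen_mem))
      (Int.natCast_dvd_natCast.1 (h'.dvd_x _ h.gen_mem))
  · apply Nat.dvd_antisymm <;> rw [← Int.natCast_dvd_natCast]
    · rw [← h.mem_iff, h'.mem_iff]
    · rw [← h'.mem_iff, h.mem_iff]

lemma conj (h : HasType H k m s) (g : Klein) :
    HasType (H.map (MulAut.conj g).toMonoidHom) k m
      (intSign g.x * s + (1 - intSign k) * g.y) := by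
  have key (p : Klein) : p ∈ H.map (MulAut.conj g).toMonoidHom ↔ g⁻¹ * p * g ∈ H := by
    constructor
    · rintro ⟨q, hq, rfl⟩
      simpa [mul_assoc] using hq
    · intro hp
      exact ⟨_, hp, by simp [mul_assoc]⟩
  refine ⟨fun y => ?_, fun p hp => ?_, ?_⟩
  · rw [key, show g⁻¹ * ⟨0, y⟩ * g = ⟨0, intSign g.x * y⟩ by
      ext
      · simp
      · simp [intSign_neg], h.mem_iff]
    constructor
    · intro hd
      simpa [← mul_assoc, intSign_mul_self] using hd.mul_left (intSign g.x)
    · exact fun hd => hd.mul_left _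
  · simpa using h.dvd_x _ ((key p).1 hp)
  · rw [key]
    convert h.gen_mem using 1
    ext
    · simp
    · simp [intSign_neg, intSign_add]
      linear_combination s * intSign_mul_self g.x

lemma index (h : HasType H k m s) (hk : 0 < k) (hm : 0 < m) : H.index = k * m := by
  have hk' : (0 : ℤ) < k := by exact_mod_cast hk
  have hm' : (0 : ℤ) < m := by exact_mod_cast hm
  let f : Fin k × Fin m → Klein ⧸ H := fun t => ((⟨t.1, t.2⟩ : Klein) : Klein ⧸ H)
  have hf : Function.Bijective f := by
    constructor
    · rintro ⟨i, j⟩ ⟨i', j'⟩ hij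
      rw [QuotientGroup.eq] at hij
      have h1 := h.dvd_x _ hij
      simp only [mul_x, inv_x] at h1
      have hi : i = i' := by
        have := Int.eq_zero_of_abs_lt_dvd h1 (by rw [abs_lt]; omega)
        ext; omega
      subst hi
      have h2 : (⟨(i : ℕ), (j : ℕ)⟩ : Klein)⁻¹ * ⟨(i : ℕ), (j' : ℕ)⟩ =
          ⟨0, intSign (i : ℕ) * ((j' : ℕ) - (j : ℕ))⟩ := by
        ext
        · simp
        · simp [intSign_neg]; ring
      rw [h2, h.mem_iff] at hij
      have h3 := hij.mul_left (intSign (i : ℕ))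
      rw [← mul_assoc, intSign_mul_self, one_mul] at h3
      have := Int.eq_zero_of_abs_lt_dvd h3 (by rw [abs_lt]; omega)
      ext
      · rfl
      · simp; omega
    · intro c
      induction c using QuotientGroup.induction_on with
      | H p =>
        set g : Klein := ⟨k, s⟩ with hg
        set v := (p * (g ^ (p.x / k))⁻¹).y with hv
        have e : p * (g ^ (p.x / k))⁻¹ = ⟨p.x % k, v⟩ := by
          ext
          · simp [hg, Int.emod_def]; ring
          · rfl
        have hx := Int.emod_nonneg p.x hk'.ne'
        have hx' := Int.emod_lt_of_pos p.x hk'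
        have hy := Int.emod_nonneg v hm'.ne'
        have hy' := Int.emod_lt_of_pos v hm'
        refine ⟨(⟨(p.x % k).toNat, by omega⟩, ⟨(v % m).toNat, by omega⟩), ?_⟩
        rw [QuotientGroup.eq]
        simp only [Int.toNat_of_nonneg hx, Int.toNat_of_nonneg hy]
        have h1 : (⟨p.x % k, v % m⟩ : Klein)⁻¹ * (p * (g ^ (p.x / k))⁻¹) ∈ H := by
          rw [e, show (⟨p.x % k, v % m⟩ : Klein)⁻¹ * ⟨p.x % k, v⟩ =
              ⟨0, intSign (p.x % k) * (v - v % m)⟩ by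
            ext
            · simp
            · simp [intSign_neg]; ring, h.mem_iff]
          exact (Int.dvd_self_sub_emod).mul_left _
        have h2 := H.mul_mem h1 (H.zpow_mem h.gen_mem (p.x / k))
        simpa [hg, mul_assoc] using h2
  have := Nat.card_eq_of_bijective f hf
  rw [Subgroup.index, ← this]
  simp

lemma exists_of_index_ne_zero (H : Subgroup Klein) (hH : H.index ≠ 0) :
    ∃ k m : ℕ, ∃ s : ℤ, 0 < k ∧ 0 < m ∧ HasType H k m s := by
  have hcyc (A : AddSubgroup ℤ) : ∃ m : ℕ, ∀ y, y ∈ A ↔ (m : ℤ) ∣ y := by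
    obtain ⟨c, rfl⟩ := Int.subgroup_cyclic A
    exact ⟨c.natAbs, fun y => by
      rw [← AddSubgroup.zmultiples_eq_closure, Int.mem_zmultiples_iff, Int.natAbs_dvd]⟩
  obtain ⟨m, hm⟩ := hcyc (H.comap yHom).toAddSubgroup'
  obtain ⟨k, hk⟩ := hcyc (H.map xHom).toAddSubgroup'
  have hm' (y : ℤ) : (⟨0, y⟩ : Klein) ∈ H ↔ (m : ℤ) ∣ y := hm y
  have hk' (x : ℤ) : (∃ p ∈ H, p.x = x) ↔ (k : ℤ) ∣ x := hk x
  obtain ⟨⟨c, s⟩, hg, rfl⟩ := (hk' k).2 dvd_rfl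
  have pos (p : Klein) : ∃ j : ℕ, 0 < j ∧ p ^ (j : ℤ) ∈ H := by
    obtain ⟨j, hj, -, hj'⟩ := Subgroup.exists_pow_mem_of_index_ne_zero hH p
    exact ⟨j, hj, by simpa using hj'⟩
  refine ⟨k, m, s, ?_, ?_, hm', fun p hp => (hk' _).1 ⟨p, hp, rfl⟩, hg⟩
  · obtain ⟨j, hj, hj'⟩ := pos ⟨1, 0⟩
    have := (hk' j).1 ⟨_, hj', by rw [zpow_x, mul_one]⟩
    exact Nat.pos_of_dvd_of_pos (Int.natCast_dvd_natCast.1 this) hj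
  · obtain ⟨j, hj, hj'⟩ := pos ⟨0, 1⟩
    rw [mk_zero_zpow, hm', mul_one] at hj'
    exact Nat.pos_of_dvd_of_pos (Int.natCast_dvd_natCast.1 hj') hj

end HasType

/-- The exponent `w` for which `(b ^ s * a ^ k) ^ j = b ^ (s * w) * a ^ (k * j)`. -/
def powExponent (k j : ℤ) : ℤ := if Even k then j else j % 2

lemma powExponent_add (k i j : ℤ) :
    powExponent k (i + j) = powExponent k i + intSign (k * i) * powExponent k j := by
  unfold powExponent
  split_ifs with h
  · rw [intSign_of_even (h.mul_right i), one_mul]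
  · rw [Int.not_even_iff_odd] at h
    rcases Int.even_or_odd i with hi | hi
    · rw [intSign_of_even (hi.mul_left k)]
      obtain ⟨c, rfl⟩ := hi
      omega
    · rw [intSign_of_odd (h.mul hi)]
      obtain ⟨c, rfl⟩ := hi
      omega

lemma powExponent_zero (k : ℤ) : powExponent k 0 = 0 := by simp [powExponent]

lemma powExponent_one (k : ℤ) : powExponent k 1 = 1 := by simp [powExponent]

/-- The subgroup generated by `b ^ m` and `b ^ s * a ^ k`. -/
def typed (k m : ℕ) (s : ℤ) : Subgroup Klein where
  carrier := {p | ∃ j : ℤ, p.x = k * j ∧ (m : ℤ) ∣ p.y - s * powExponent k j}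
  one_mem' := ⟨0, by simp [powExponent_zero]⟩
  mul_mem' := by
    rintro p q ⟨i, hi, u, hu⟩ ⟨j, hj, v, hv⟩
    refine ⟨i + j, by simp [hi, hj, mul_add], u + intSign (k * i) * v, ?_⟩
    rw [mul_y, powExponent_add, hi]
    linear_combination hu + intSign (k * i) * hv
  inv_mem' := by
    rintro p ⟨i, hi, u, hu⟩
    refine ⟨-i, by simp [hi], -(intSign (k * i) * u), ?_⟩
    have h := powExponent_add k i (-i)
    rw [add_neg_cancel, powExponent_zero] at h
    rw [inv_y, hi]
    linear_combination -intSign (k * i) * hu + intSign (k * i) * s * h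
      + s * powExponent k (-i) * intSign_mul_self (k * i)

lemma hasType_typed {k : ℕ} (hk : 0 < k) (m : ℕ) (s : ℤ) : HasType (typed k m s) k m s where
  mem_iff y := by
    have hk' : (k : ℤ) ≠ 0 := by exact_mod_cast hk.ne'
    constructor
    · rintro ⟨j, hj, hd⟩
      have : j = 0 := (mul_eq_zero.1 hj.symm).resolve_left hk'
      subst this
      simpa [powExponent_zero] using hd
    · exact fun hd => ⟨0, by simp, by simpa [powExponent_zero] using hd⟩
  dvd_x := by
    rintro p ⟨j, hj, -⟩
    exact ⟨j, hj⟩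
  gen_mem := ⟨1, by simp, by simp [powExponent_one]⟩

/-- The number of conjugacy classes among the subgroups of type `(k, m, s)` with `k`, `m` fixed. -/
def classCount (k m : ℕ) : ℕ := if Even k then m / 2 + 1 else if Even m then 2 else 1

lemma exists_lt_classCount (k : ℕ) {m : ℕ} (hm : 0 < m) (s : ℤ) :
    ∃ t < classCount k m, ∃ x y : ℤ, (m : ℤ) ∣ t - (intSign x * s + (1 - intSign k) * y) := by
  have hm' : (0 : ℤ) < m := by exact_mod_cast hm
  have h1 := Int.emod_nonneg s hm'.ne'
  have h2 := Int.emod_lt_of_pos s hm'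
  have h3 : (m : ℤ) ∣ s - s % m := Int.dvd_self_sub_emod
  unfold classCount
  split_ifs with hk he
  · by_cases h : s % m ≤ m / 2
    · refine ⟨(s % m).toNat, by omega, 0, 0, ?_⟩
      rw [intSign_zero, Int.toNat_of_nonneg h1, dvd_sub_comm]
      simpa using h3
    · refine ⟨(m - s % m).toNat, by omega, 1, 0, ?_⟩
      rw [intSign_one, Int.toNat_of_nonneg (by omega)]
      rw [show m - s % m - (-1 * s + (1 - intSign k) * 0) = m + (s - s % m) by ring]
      exact (dvd_refl (m : ℤ)).add h3
  · rw [Nat.not_even_iff_odd] at hk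
    refine ⟨(s % 2).toNat, by omega, 0, -(s / 2), ?_⟩
    rw [intSign_zero, intSign_of_odd (by exact_mod_cast hk), Int.toNat_of_nonneg (by omega)]
    rw [show s % 2 - (1 * s + (1 - -1) * -(s / 2)) = 0 by omega]
    exact dvd_zero _
  · rw [Nat.not_even_iff_odd] at hk he
    obtain ⟨c, rfl⟩ := he
    refine ⟨0, by simp, 0, s * c, ?_⟩
    rw [intSign_zero, intSign_of_odd (by exact_mod_cast hk)]
    exact ⟨-s, by push_cast; ring⟩

lemma eq_of_lt_classCount {k m t t' : ℕ} (ht : t < classCount k m)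
    (ht' : t' < classCount k m) {x y : ℤ}
    (h : (m : ℤ) ∣ t' - (intSign x * t + (1 - intSign k) * y)) : t = t' := by
  have hx : intSign x = 1 ∨ intSign x = -1 := by
    rcases Int.even_or_odd x with hx | hx
    · exact Or.inl (intSign_of_even hx)
    · exact Or.inr (intSign_of_odd hx)
  unfold classCount at ht ht'
  split_ifs at ht ht' with hk he
  · rw [intSign_of_even (x := k) (by exact_mod_cast hk), sub_self, zero_mul, add_zero] at h
    rcases hx with hx | hx <;> rw [hx] at h
    · rcases Nat.eq_zero_or_pos m with rfl | hm
      · omega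
      have := Int.eq_zero_of_abs_lt_dvd h (by rw [abs_lt]; omega)
      omega
    · obtain ⟨c, hc⟩ := h
      have hc1 : (t' : ℤ) + t = m * c := by linear_combination hc
      rcases lt_trichotomy c 1 with h1 | rfl | h1
      · have : (m : ℤ) * c ≤ 0 := mul_nonpos_of_nonneg_of_nonpos (by omega) (by omega)
        omega
      · omega
      · rcases Nat.eq_zero_or_pos m with rfl | hm
        · omega
        · have : (m : ℤ) * 2 ≤ m * c := mul_le_mul_of_nonneg_left (by omega) (by omega)
          omega
  · rw [Nat.not_even_iff_odd] at hk
    rw [intSign_of_odd (x := k) (by exact_mod_cast hk)] at h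
    obtain ⟨c, rfl⟩ := he
    have h2 : (2 : ℤ) ∣ t' - (intSign x * t + (1 - -1) * y) :=
      dvd_trans (b := ((c + c : ℕ) : ℤ)) ⟨c, by push_cast; ring⟩ h
    rcases hx with hx | hx <;> rw [hx] at h2 <;> omega
  · omega

/-- Conjugacy of subgroups of index `n`. -/
def IsConjIndex (G : Type*) [Group G] (n : ℕ) (H K : {H : Subgroup G // H.index = n}) : Prop :=
  ∃ g, K.1 = Subgroup.map (MulAut.conj g).toMonoidHom H.1

lemma equivalence_isConjIndex (G : Type*) [Group G] (n : ℕ) :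
    Equivalence (IsConjIndex G n) where
  refl H := ⟨1, by
    rw [map_one]
    exact (Subgroup.map_id H.1).symm⟩
  symm := by
    rintro H K ⟨g, hg⟩
    refine ⟨g⁻¹, ?_⟩
    rw [hg, Subgroup.map_map]
    convert (Subgroup.map_id H.1).symm using 2
    ext x
    simp [mul_assoc]
  trans := by
    rintro H K L ⟨g, hg⟩ ⟨g', hg'⟩
    refine ⟨g' * g, ?_⟩
    rw [hg', hg, Subgroup.map_map]
    congr 1
    ext x
    simp

lemma card_quot_isConjIndex_congr {G G' : Type*} [Group G] [Group G'] (e : G ≃* G') (n : ℕ) :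
    Nat.card (Quot (IsConjIndex G n)) = Nat.card (Quot (IsConjIndex G' n)) := by
  refine Nat.card_congr (Quot.congr (e.mapSubgroup.toEquiv.subtypeEquiv fun H => ?_) ?_)
  · have : (H.map e.toMonoidHom).index = H.index := Subgroup.index_map_equiv H e
    change _ ↔ (H.map e.toMonoidHom).index = n
    rw [this]
  · rintro ⟨H, hH⟩ ⟨K, hK⟩
    change (∃ g, K = _) ↔ ∃ g, K.map e.toMonoidHom = (H.map e.toMonoidHom).map _
    have key (g : G) : (H.map e.toMonoidHom).map (MulAut.conj (e g)).toMonoidHom =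
        (H.map (MulAut.conj g).toMonoidHom).map e.toMonoidHom := by
      rw [Subgroup.map_map, Subgroup.map_map]
      congr 1
      ext x
      simp
    rw [← e.toEquiv.exists_congr_right]
    refine exists_congr fun g => ?_
    change _ ↔ _ = (H.map e.toMonoidHom).map (MulAut.conj (e g)).toMonoidHom
    rw [key]
    exact (Subgroup.map_injective e.injective).eq_iff.symm

lemma card_quot_isConjIndex {n : ℕ} (hn : 1 ≤ n) :
    Nat.card (Quot (IsConjIndex Klein n)) = ∑ m ∈ n.divisors, classCount (n / m) m := by
  let R := n.divisors.sigma fun m => Finset.range (classCount (n / m) m)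
  have hR : ∑ m ∈ n.divisors, classCount (n / m) m = Nat.card R := by
    rw [Nat.card_eq_fintype_card, Fintype.card_coe, Finset.card_sigma]
    simp
  have pos (r : R) : 0 < r.1.1 ∧ 0 < n / r.1.1 ∧ n / r.1.1 * r.1.1 = n ∧
      r.1.2 < classCount (n / r.1.1) r.1.1 := by
    obtain ⟨⟨m, t⟩, hr⟩ := r
    simp only [R, Finset.mem_sigma, Nat.mem_divisors, Finset.mem_range] at hr
    have hm := Nat.pos_of_dvd_of_pos hr.1.1 hn
    exact ⟨hm, Nat.div_pos (Nat.le_of_dvd hn hr.1.1) hm, Nat.div_mul_cancel hr.1.1, hr.2⟩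
  let f : R → Quot (IsConjIndex Klein n) := fun r =>
    Quot.mk _ ⟨typed (n / r.1.1) r.1.1 r.1.2,
      ((hasType_typed (pos r).2.1 _ _).index (pos r).2.1 (pos r).1).trans (pos r).2.2.1⟩
  rw [hR]
  refine (Nat.card_eq_of_bijective f ⟨fun r r' hrr => ?_, fun c => ?_⟩).symm
  · obtain ⟨g, hg⟩ := (equivalence_isConjIndex Klein n).eqvGen_iff.1 (Quot.eqvGen_exact hrr)
    have h1 := (hasType_typed (pos r).2.1 r.1.1 r.1.2).conj g
    have h2 := hasType_typed (pos r').2.1 r'.1.1 r'.1.2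
    rw [← hg] at h1
    obtain ⟨⟨m, t⟩, hr⟩ := r
    obtain ⟨⟨m', t'⟩, hr'⟩ := r'
    obtain ⟨-, rfl⟩ : _ ∧ m = m' := h1.unique h2
    obtain rfl : t = t' := eq_of_lt_classCount (pos ⟨_, hr⟩).2.2.2 (pos ⟨_, hr'⟩).2.2.2
      (h1.dvd_sub h2)
    rfl
  · induction c using Quot.ind with
    | mk H =>
      obtain ⟨H, hH⟩ := H
      obtain ⟨k, m, s, hk, hm, h⟩ := HasType.exists_of_index_ne_zero H (by omega)
      have hkm : k * m = n := (h.index hk hm).symm.trans hH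
      have hdiv : n / m = k := by rw [← hkm, Nat.mul_div_cancel _ hm]
      obtain ⟨t, ht, x, y, hxy⟩ := exists_lt_classCount k hm s
      refine ⟨⟨⟨m, t⟩, ?_⟩, ?_⟩
      · simp only [R, Finset.mem_sigma, Nat.mem_divisors, Finset.mem_range, hdiv]
        exact ⟨⟨⟨k, by rw [← hkm, mul_comm]⟩, by omega⟩, ht⟩
      · refine (Quot.sound ⟨⟨x, y⟩, ?_⟩).symm
        simp only [hdiv]
        exact (hasType_typed hk m t).eq ((h.conj ⟨x, y⟩).congr_mod hxy)

end Klein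

open Klein in
lemma sum_classCount {n : ℕ} (hn : 1 ≤ n) :
    ∑ m ∈ n.divisors, classCount (n / m) m = ∑ d ∈ n.divisors, kleinA d := by
  rcases Nat.even_or_odd n with he | ho
  · obtain ⟨N, hN⟩ := he
    have hN0 : N ≠ 0 := by omega
    have hn2 : n = 2 * N := by omega
    have hodd : n.divisors.filter (fun d => ¬ Even d) = N.divisors.filter (fun d => ¬ Even d) := by
      ext d
      simp only [Finset.mem_filter, Nat.mem_divisors, Nat.not_even_iff_odd]
      refine ⟨fun ⟨⟨h, _⟩, h'⟩ => ⟨⟨?_, hN0⟩, h'⟩, fun ⟨⟨h, _⟩, h'⟩ => ⟨⟨?_, by omega⟩, h'⟩⟩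
      · rw [hn2] at h
        exact (Nat.Coprime.dvd_mul_left h'.coprime_two_right).1 h
      · exact hn2 ▸ h.mul_left 2
    have heven : n.divisors.filter (fun d => Even d) = N.divisors.image (2 * ·) := by
      ext d
      simp only [Finset.mem_filter, Nat.mem_divisors, Finset.mem_image]
      constructor
      · rintro ⟨⟨h, _⟩, c, rfl⟩
        refine ⟨c, ⟨?_, hN0⟩, by ring⟩
        rw [hn2, ← two_mul] at h
        exact Nat.dvd_of_mul_dvd_mul_left two_pos h
      · rintro ⟨c, ⟨h, _⟩, rfl⟩
        exact ⟨⟨hn2 ▸ Nat.mul_dvd_mul_left 2 h, by omega⟩, even_two_mul c⟩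
    have hinj : Set.InjOn (2 * · : ℕ → ℕ) N.divisors := fun a _ b _ h => by simpa using h
    rw [← Nat.sum_div_divisors n (fun m => classCount (n / m) m),
      ← Finset.sum_filter_add_sum_filter_not _ (fun d => Even d),
      ← Finset.sum_filter_add_sum_filter_not (f := kleinA) _ (fun d => Even d),
      heven, Finset.sum_image hinj, Finset.sum_image hinj, hodd]
    have h1 : ∑ d ∈ N.divisors, classCount (n / (n / (2 * d))) (n / (2 * d)) =
        ∑ d ∈ N.divisors, (d / 2 + 1) := by
      rw [← Nat.sum_div_divisors N (fun d => d / 2 + 1)]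
      refine Finset.sum_congr rfl fun d hd => ?_
      have hd' := Nat.dvd_of_mem_divisors hd
      rw [Nat.div_div_self (hn2 ▸ Nat.mul_dvd_mul_left 2 hd') (by omega), classCount,
        if_pos (even_two_mul d), hn2, Nat.mul_div_mul_left _ _ two_pos]
    have h2 : ∑ d ∈ N.divisors with ¬ Even d, classCount (n / (n / d)) (n / d) =
        ∑ d ∈ N.divisors with ¬ Even d, 2 := by
      refine Finset.sum_congr rfl fun d hd => ?_
      obtain ⟨hd, hd2⟩ := Finset.mem_filter.1 hd
      have hd' := Nat.dvd_of_mem_divisors hd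
      rw [Nat.div_div_self (hn2 ▸ hd'.mul_left 2) (by omega), classCount, if_neg hd2, hn2,
        Nat.mul_div_assoc _ hd', if_pos (even_two_mul _)]
    have h3 : ∑ d ∈ N.divisors, kleinA (2 * d) =
        ∑ d ∈ N.divisors, (d / 2 + 1) + ∑ d ∈ N.divisors with ¬ Even d, 1 := by
      rw [Finset.sum_filter, ← Finset.sum_add_distrib]
      refine Finset.sum_congr rfl fun d hd => ?_
      unfold kleinA
      simp only [Nat.even_iff]
      split_ifs <;> omega
    have h4 : ∑ d ∈ N.divisors with ¬ Even d, kleinA d = ∑ d ∈ N.divisors with ¬ Even d, 1 := by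
      refine Finset.sum_congr rfl fun d hd => ?_
      have := (Finset.mem_filter.1 hd).2
      rw [Nat.not_even_iff] at this
      simp [kleinA, this]
    rw [h1, h2, h3, h4]
    simp
    ring
  · refine Finset.sum_congr rfl fun d hd => ?_
    have hd' := Nat.dvd_of_mem_divisors hd
    have h1 := ho.of_dvd_nat hd'
    have h2 := ho.of_dvd_nat (Nat.div_dvd_of_dvd hd')
    simp [classCount, kleinA, Nat.odd_iff.1 h1, Nat.not_even_iff_odd.2 h1,
      Nat.not_even_iff_odd.2 h2]

theorem stmt_17 (n : ℕ) (hn : 1 ≤ n) :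
    Nat.card (Quot fun H K : {H : Subgroup (PresentedGroup kleinRels) // H.index = n} =>
        ∃ g, K.1 = Subgroup.map (MulAut.conj g).toMonoidHom H.1) =
      ∑ d ∈ n.divisors, kleinA d :=
  (Klein.card_quot_isConjIndex_congr Klein.presentedEquiv n).trans
    ((Klein.card_quot_isConjIndex hn).trans (sum_classCount hn))
end

section
/- Let d ≥ 2 and let G = ⟨a, b ∣ a b a^{-1} = b^d⟩ be the Baumslag–Solitar group BS(1,d). Let S = {(m, i) : m ≥ 1, gcd(m, d) = 1, 0 ≤ i < m}, and define (m_1, i_1) ∼ (m_2, i_2) if and only if m_1 = m_2 and i_1 ≡ i_2·d^j (mod m_1) for some integer j ≥ 0. Define the degree of (m, i) to be m·l, where l is the multiplicative order of d in (ℤ/m'ℤ)^× with m' = m / gcd(m, i) (for i = 0 set m' = 1 and l = 1). Then for every n ≥ 1, the number of conjugacy classes of subgroups of index n in G equals the number of ∼-equivalence classes of elements of S whose degree divides n. -/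
/-- The single relator `a b a⁻¹ b^{-d}` of the Baumslag–Solitar group `BS(1,d)`
(with `a` the generator indexed by `0` and `b` the generator indexed by `1`). -/
def bsRels (d : ℕ) : Set (FreeGroup (Fin 2)) :=
  {FreeGroup.of 0 * FreeGroup.of 1 * (FreeGroup.of 0)⁻¹ * (FreeGroup.of 1) ^ (-(d : ℤ))}

/-- The degree of a pair `(m, i)`: `m` times the multiplicative order of `d`
modulo `m' = m / gcd(m, i)`.  (For `i = 0` we get `m' = 1` and the order is `1`.) -/
noncomputable def bsDeg (d m i : ℕ) : ℕ :=
  m * orderOf ((d : ZMod (m / Nat.gcd m i)))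

/-- Two generators `a`, `b` of a group satisfying the Baumslag–Solitar relation
`a b a⁻¹ = b ^ d`. -/
structure IsBSGenerators {G : Type*} [Group G] (a b : G) (d : ℕ) : Prop where
  conj_eq : a * b * a⁻¹ = b ^ d
  closure_eq : Subgroup.closure {a, b} = ⊤

/-- A subgroup `H` of index `m * k` containing `b ^ m` and `b ^ (-x) * a ^ k`. -/
structure HasBSType {G : Type*} [Group G] (a b : G) (m k : ℕ) (x : ℤ) (H : Subgroup G) :
    Prop where
  index_eq : H.index = m * k
  pow_mem : b ^ m ∈ H
  mem : b ^ (-x) * a ^ k ∈ H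

theorem mem_map_conj_iff {G : Type*} [Group G] {H : Subgroup G} {g y : G} :
    y ∈ H.map (MulAut.conj g).toMonoidHom ↔ g⁻¹ * y * g ∈ H := by
  rw [Subgroup.mem_map]
  constructor
  · rintro ⟨h, hh, rfl⟩
    simpa [mul_assoc] using hh
  · intro hy
    exact ⟨_, hy, by simp [mul_assoc]⟩

theorem index_map_conj {G : Type*} [Group G] (H : Subgroup G) (g : G) :
    (H.map (MulAut.conj g).toMonoidHom).index = H.index :=
  Subgroup.index_map_equiv H (MulAut.conj g)

theorem Subgroup.eq_of_le_of_index_le {G : Type*} [Group G] {H K : Subgroup G}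
    [H.FiniteIndex] (hle : H ≤ K) (h : H.index ≤ K.index) : H = K := by
  refine le_antisymm hle (Subgroup.relIndex_eq_one.mp ?_)
  have h1 := Subgroup.relIndex_mul_index hle
  have h2 : H.index ≠ 0 := Subgroup.FiniteIndex.index_ne_zero
  have h3 := Nat.pos_of_ne_zero (left_ne_zero_of_mul (h1.trans_ne h2))
  have h4 := Nat.pos_of_ne_zero (right_ne_zero_of_mul (h1.trans_ne h2))
  nlinarith

namespace IsBSGenerators

variable {G : Type*} [Group G] {a b : G} {d : ℕ}

theorem mul_zpow (h : IsBSGenerators a b d) (s : ℤ) : a * b ^ s = b ^ (s * d) * a := by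
  have h1 : (a * b * a⁻¹) ^ s = (b ^ d) ^ s := by rw [h.conj_eq]
  rw [conj_zpow, ← zpow_natCast, ← zpow_mul, mul_inv_eq_iff_eq_mul] at h1
  rw [h1, mul_comm]

theorem pow_mul_zpow (h : IsBSGenerators a b d) (t : ℕ) (s : ℤ) :
    a ^ t * b ^ s = b ^ (s * d ^ t) * a ^ t := by
  induction t generalizing s with
  | zero => simp
  | succ t ih =>
    rw [pow_succ, mul_assoc, h.mul_zpow, ← mul_assoc, ih, mul_assoc, pow_succ]
    ring_nf

open scoped Pointwise in
/-- In a finite action, a set mapped into itself by both generators is invariant. -/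
theorem smul_mem (h : IsBSGenerators a b d) {X : Type*} [MulAction G X] [Finite X] {Y : Set X}
    (ha : ∀ q ∈ Y, a • q ∈ Y) (hb : ∀ q ∈ Y, b • q ∈ Y) (g : G) {q : X} (hq : q ∈ Y) :
    g • q ∈ Y := by
  have key : (⊤ : Subgroup G) ≤ MulAction.stabilizer G Y := by
    rw [← h.closure_eq, Subgroup.closure_le]
    rintro c (rfl | rfl)
    · rw [SetLike.mem_coe, MulAction.mem_stabilizer_set_iff_smul_set_subset Y.toFinite]
      rintro _ ⟨q, hq, rfl⟩
      exact ha q hq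
    · rw [SetLike.mem_coe, MulAction.mem_stabilizer_set_iff_smul_set_subset Y.toFinite]
      rintro _ ⟨q, hq, rfl⟩
      exact hb q hq
  exact (MulAction.mem_stabilizer_set.mp (key (Subgroup.mem_top g)) q).mpr hq

theorem coprime_period (h : IsBSGenerators a b d) {X : Type*} [MulAction G X] [Finite X]
    (q : X) : (MulAction.period b q).Coprime d := by
  set f := MulAction.toPermHom G X
  have h1 : f a * f b * (f a)⁻¹ = f b ^ d := by
    rw [← map_mul, ← map_inv, ← map_mul, h.conj_eq, map_pow]
  have h2 : orderOf (f b ^ d) = orderOf (f b) := by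
    rw [← h1]
    exact orderOf_injective (MulAut.conj (f a)).toMonoidHom (MulAut.conj (f a)).injective (f b)
  rw [orderOf_pow] at h2
  have hpos : 0 < orderOf (f b) := orderOf_pos _
  have h3 : (orderOf (f b)).gcd d = 1 := by
    have hdvd := Nat.gcd_dvd_left (orderOf (f b)) d
    have h4 := Nat.div_mul_cancel hdvd
    rw [h2] at h4
    exact Nat.eq_of_mul_eq_mul_left hpos (by omega)
  refine Nat.Coprime.coprime_dvd_left ?_ h3
  rw [← MulAction.pow_smul_eq_iff_period_dvd]
  change f (b ^ orderOf (f b)) q = q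
  rw [map_pow, pow_orderOf_eq_one, Equiv.Perm.one_apply]

theorem pow_smul_smul (h : IsBSGenerators a b d) {X : Type*} [MulAction G X] [Finite X]
    {m : ℕ} {q : X} (hq : b ^ m • q = q) (g : G) : b ^ m • g • q = g • q := by
  refine h.smul_mem (Y := {q | b ^ m • q = q}) ?_ ?_ g hq
  · intro q hq
    have h1 : b ^ (m * d) • a • q = a • q := by
      have := h.mul_zpow m
      rw [← Nat.cast_mul, zpow_natCast, zpow_natCast] at this
      rw [smul_smul, ← this, mul_smul, hq]
    rw [MulAction.pow_smul_eq_iff_period_dvd] at h1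
    exact MulAction.pow_smul_eq_iff_period_dvd.mpr
      ((h.coprime_period (a • q)).dvd_of_dvd_mul_right h1)
  · intro q hq
    rw [Set.mem_ofPred_eq] at hq ⊢
    rw [smul_smul, ← pow_succ, pow_succ', mul_smul, hq]

theorem conj_pow_mem (h : IsBSGenerators a b d) {K : Subgroup G} [K.FiniteIndex] {m : ℕ}
    (hm : b ^ m ∈ K) (g : G) : g⁻¹ * b ^ m * g ∈ K := by
  have h1 : b ^ m • ((1 : G) : G ⧸ K) = ((1 : G) : G ⧸ K) := by
    rw [MulAction.Quotient.smul_coe, eq_comm, QuotientGroup.eq]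
    simpa using hm
  have h2 := h.pow_smul_smul h1 g
  rw [MulAction.Quotient.smul_coe, MulAction.Quotient.smul_coe, eq_comm, QuotientGroup.eq] at h2
  simpa [mul_assoc] using h2

theorem exists_eq_mul (h : IsBSGenerators a b d) {K : Subgroup G} [K.FiniteIndex] {m k : ℕ}
    {x : ℤ} (hm : 0 < m) (hk : 0 < k) (hb : b ^ m ∈ K) (ha : b ^ (-x) * a ^ k ∈ K) (g : G) :
    ∃ s < m, ∃ t < k, ∃ y ∈ K, g = b ^ s * a ^ t * y := by
  have key : g • ((1 : G) : G ⧸ K) ∈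
      {q : G ⧸ K | ∃ s : ℤ, ∃ t < k, q = ((b ^ s * a ^ t : G) : G ⧸ K)} := by
    refine h.smul_mem ?_ ?_ g ⟨0, 0, hk, by simp⟩
    · rintro _ ⟨s, t, ht, rfl⟩
      have h1 : a * (b ^ s * a ^ t) = b ^ (s * d) * a ^ (t + 1) := by
        rw [← mul_assoc, h.mul_zpow, mul_assoc, pow_succ']
      rw [MulAction.Quotient.smul_coe, smul_eq_mul, h1]
      obtain ht | ht := (Nat.succ_le_of_lt ht).lt_or_eq
      · exact ⟨_, _, ht, rfl⟩
      · refine ⟨s * d + x, 0, hk, ?_⟩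
        rw [Nat.succ_eq_add_one] at ht
        rw [eq_comm, QuotientGroup.eq, ht]
        convert ha using 1
        group
    · rintro _ ⟨s, t, ht, rfl⟩
      exact ⟨s + 1, t, ht, by
        rw [MulAction.Quotient.smul_coe, smul_eq_mul, ← mul_assoc, ← zpow_one_add, add_comm]⟩
  obtain ⟨s, t, ht, hst⟩ := key
  rw [MulAction.Quotient.smul_coe, smul_eq_mul, mul_one, eq_comm, QuotientGroup.eq] at hst
  have hm' : (m : ℤ) ≠ 0 := by positivity
  obtain ⟨s', hs'⟩ := Int.eq_ofNat_of_zero_le (Int.emod_nonneg s hm')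
  have hlt := Int.emod_lt_of_pos s (by positivity : (0 : ℤ) < m)
  refine ⟨s', by omega, t, ht, ((a ^ t)⁻¹ * b ^ m * a ^ t) ^ (s / m) *
    ((b ^ s * a ^ t)⁻¹ * g), mul_mem (zpow_mem (h.conj_pow_mem hb _) _) hst, ?_⟩
  have h2 : ((a ^ t)⁻¹ * b ^ m * a ^ t) ^ (s / m) = (a ^ t)⁻¹ * b ^ (m * (s / m)) * a ^ t := by
    have := conj_zpow (i := s / m) (a := (a ^ t)⁻¹) (b := b ^ m)
    rw [inv_inv] at this
    rw [this, ← zpow_natCast b m, ← zpow_mul]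
  have h3 : b ^ s = b ^ s' * b ^ (m * (s / m)) := by
    rw [← zpow_natCast b s', ← zpow_add]
    congr 1
    have := Int.emod_add_mul_ediv s m
    omega
  rw [h2, h3]
  group

theorem exists_surjective (h : IsBSGenerators a b d) {K : Subgroup G} [K.FiniteIndex]
    {m k : ℕ} {x : ℤ} (hm : 0 < m) (hk : 0 < k) (hb : b ^ m ∈ K)
    (ha : b ^ (-x) * a ^ k ∈ K) :
    Function.Surjective fun p : Fin m × Fin k => ((b ^ (p.1 : ℕ) * a ^ (p.2 : ℕ) : G) : G ⧸ K) := by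
  intro q
  obtain ⟨g, rfl⟩ := QuotientGroup.mk_surjective q
  obtain ⟨s, hs, t, ht, y, hy, rfl⟩ := h.exists_eq_mul hm hk hb ha g
  refine ⟨(⟨s, hs⟩, ⟨t, ht⟩), ?_⟩
  rw [QuotientGroup.eq]
  simpa [mul_assoc] using hy

theorem index_le (h : IsBSGenerators a b d) {K : Subgroup G} [K.FiniteIndex]
    {m k : ℕ} {x : ℤ} (hm : 0 < m) (hk : 0 < k) (hb : b ^ m ∈ K)
    (ha : b ^ (-x) * a ^ k ∈ K) : K.index ≤ m * k := by
  have := Nat.card_le_card_of_surjective _ (h.exists_surjective hm hk hb ha)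
  simpa [Subgroup.index] using this

end IsBSGenerators

namespace HasBSType

variable {G : Type*} [Group G] {a b : G} {d m k : ℕ} {x : ℤ} {H : Subgroup G}

theorem finiteIndex (hH : HasBSType a b m k x H) (hm : 0 < m) (hk : 0 < k) : H.FiniteIndex :=
  ⟨by rw [hH.index_eq]; positivity⟩

theorem eq (h : IsBSGenerators a b d) (hm : 0 < m) (hk : 0 < k) (hH : HasBSType a b m k x H)
    {K : Subgroup G} (hK : HasBSType a b m k x K) : H = K := by
  have := hH.finiteIndex hm hk
  have := hK.finiteIndex hm hk
  have key := h.index_le (K := H ⊓ K) hm hk ⟨hH.pow_mem, hK.pow_mem⟩ ⟨hH.mem, hK.mem⟩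
  exact (Subgroup.eq_of_le_of_index_le inf_le_left (key.trans_eq hH.index_eq.symm)).symm.trans
    (Subgroup.eq_of_le_of_index_le inf_le_right (key.trans_eq hK.index_eq.symm))

theorem pow_mem_iff (h : IsBSGenerators a b d) (hm : 0 < m) (hk : 0 < k)
    (hH : HasBSType a b m k x H) (j : ℤ) : b ^ j ∈ H ↔ (m : ℤ) ∣ j := by
  have := hH.finiteIndex hm hk
  constructor
  · intro hj
    have hbij := (h.exists_surjective hm hk hH.pow_mem hH.mem).bijective_of_nat_card_le
      (by simpa [Subgroup.index] using hH.index_eq.ge)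
    have hm' : (m : ℤ) ≠ 0 := by positivity
    obtain ⟨s, hs⟩ := Int.eq_ofNat_of_zero_le (Int.emod_nonneg j hm')
    have hlt := Int.emod_lt_of_pos j (by positivity : (0 : ℤ) < m)
    have hsm : b ^ s ∈ H := by
      have h1 : b ^ s = b ^ j * (b ^ m) ^ (-(j / m)) := by
        rw [← zpow_natCast b m, ← zpow_mul, ← zpow_natCast, ← zpow_add]
        congr 1
        have := Int.emod_add_mul_ediv j m
        rw [mul_neg]
        omega
      rw [h1]
      exact mul_mem hj (zpow_mem hH.pow_mem _)
    have h2 : ((⟨s, by omega⟩, ⟨0, hk⟩) : Fin m × Fin k) = (⟨0, hm⟩, ⟨0, hk⟩) := by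
      refine hbij.1 ?_
      simp only [pow_zero, mul_one]
      rw [eq_comm, QuotientGroup.eq]
      simpa using hsm
    have h3 : s = 0 := by simpa using h2
    exact Int.dvd_of_emod_eq_zero (by omega)
  · rintro ⟨c, rfl⟩
    rw [zpow_mul, zpow_natCast]
    exact zpow_mem hH.pow_mem c

theorem congr (hH : HasBSType a b m k x H) {y : ℤ} (hy : x ≡ y [ZMOD m]) :
    HasBSType a b m k y H := by
  refine ⟨hH.index_eq, hH.pow_mem, ?_⟩
  obtain ⟨c, hc⟩ := hy.dvd
  have h1 : b ^ (-y) * a ^ k = (b ^ m) ^ (-c) * (b ^ (-x) * a ^ k) := by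
    rw [← zpow_natCast b m, ← zpow_mul, ← mul_assoc, ← zpow_add]
    congr 2
    rw [mul_neg]
    omega
  rw [h1]
  exact mul_mem (zpow_mem hH.pow_mem _) hH.mem

theorem unique (h : IsBSGenerators a b d) (hm : 0 < m) (hk : 0 < k)
    (hH : HasBSType a b m k x H) {m' k' : ℕ} {x' : ℤ} (hm' : 0 < m') (hk' : 0 < k')
    (hH' : HasBSType a b m' k' x' H) : m = m' ∧ k = k' ∧ x ≡ x' [ZMOD m] := by
  have hmm : m = m' := by
    apply Nat.dvd_antisymm
    · have := (hH.pow_mem_iff h hm hk m').mp (by simpa using hH'.pow_mem)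
      exact_mod_cast this
    · have := (hH'.pow_mem_iff h hm' hk' m).mp (by simpa using hH.pow_mem)
      exact_mod_cast this
  subst hmm
  have hkk : k = k' := Nat.eq_of_mul_eq_mul_left hm (hH.index_eq.symm.trans hH'.index_eq)
  subst hkk
  refine ⟨rfl, rfl, (Int.modEq_iff_dvd.mpr ((hH.pow_mem_iff h hm hk _).mp ?_))⟩
  have := mul_mem hH.mem (inv_mem hH'.mem)
  convert this using 1
  group

theorem map_conj (h : IsBSGenerators a b d) (hm : 0 < m) (hk : 0 < k)
    (hH : HasBSType a b m k x H) (y : ℤ) (t : ℕ) :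
    HasBSType a b m k (x * d ^ t + y * (d ^ k - 1))
      (H.map (MulAut.conj (b ^ y * a ^ t)).toMonoidHom) := by
  have := hH.finiteIndex hm hk
  refine ⟨by rw [index_map_conj, hH.index_eq],
    mem_map_conj_iff.mpr (h.conj_pow_mem hH.pow_mem _), Subgroup.mem_map.mpr
      ⟨_, hH.mem, ?_⟩⟩
  have h1 : (MulAut.conj (b ^ y * a ^ t)).toMonoidHom (b ^ (-x) * a ^ k) =
      b ^ y * (a ^ t * b ^ (-x)) * a ^ k * (a ^ t)⁻¹ * (b ^ y)⁻¹ := by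
    simp only [MulEquiv.toMonoidHom_eq_coe, MonoidHom.coe_coe, MulAut.conj_apply, mul_inv_rev,
      mul_assoc]
  rw [h1, h.pow_mul_zpow, ← zpow_neg]
  have h2 : b ^ y * (b ^ (-x * d ^ t) * a ^ t) * a ^ k * (a ^ t)⁻¹ * b ^ (-y) =
      b ^ y * b ^ (-x * d ^ t) * (a ^ k * b ^ (-y)) := by
    have : a ^ t * a ^ k = a ^ k * a ^ t := by rw [← pow_add, ← pow_add, add_comm]
    simp only [mul_assoc]
    rw [← mul_assoc (a ^ t) (a ^ k), this]
    simp [mul_assoc]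
  rw [h2, h.pow_mul_zpow, ← mul_assoc, ← zpow_add, ← zpow_add]
  congr 2
  ring

theorem conj_iff (h : IsBSGenerators a b d) (hm : 0 < m) (hk : 0 < k)
    (hH : HasBSType a b m k x H) {m' k' : ℕ} {x' : ℤ} (hm' : 0 < m') (hk' : 0 < k')
    {H' : Subgroup G} (hH' : HasBSType a b m' k' x' H') :
    (∃ g, H' = H.map (MulAut.conj g).toMonoidHom) ↔
      m = m' ∧ k = k' ∧ ∃ (j : ℕ) (r : ℤ), x * d ^ j + r * (d ^ k - 1) ≡ x' [ZMOD m] := by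
  have := hH.finiteIndex hm hk
  constructor
  · rintro ⟨g, rfl⟩
    obtain ⟨s, -, t, -, y, hy, rfl⟩ := h.exists_eq_mul hm hk hH.pow_mem hH.mem g
    have h1 : H.map (MulAut.conj (b ^ s * a ^ t * y)).toMonoidHom =
        H.map (MulAut.conj (b ^ (s : ℤ) * a ^ t)).toMonoidHom := by
      ext z
      rw [mem_map_conj_iff, mem_map_conj_iff, zpow_natCast]
      have h2 : (b ^ s * a ^ t * y)⁻¹ * z * (b ^ s * a ^ t * y) =
          y⁻¹ * ((b ^ s * a ^ t)⁻¹ * z * (b ^ s * a ^ t)) * y := by group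
      rw [h2, Subgroup.mul_mem_cancel_right _ hy, Subgroup.mul_mem_cancel_left _ (inv_mem hy)]
    rw [h1] at hH'
    obtain ⟨h3, h4, h5⟩ := (hH.map_conj h hm hk s t).unique h hm hk hm' hk' hH'
    exact ⟨h3, h4, t, s, h5⟩
  · rintro ⟨rfl, rfl, j, r, hjr⟩
    exact ⟨b ^ r * a ^ j, hH'.eq h hm hk ((hH.map_conj h hm hk r j).congr hjr)⟩

end HasBSType

/-- The action of the generator `a` on the transitive `BS(1,d)`-set `ZMod m × ZMod k`
with twist `x`. -/
def bsPermA {m k : ℕ} (u : (ZMod m)ˣ) (x : ZMod m) : Equiv.Perm (ZMod m × ZMod k) where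
  toFun p := (u * p.1 + if p.2 = -1 then x else 0, p.2 + 1)
  invFun p := (u⁻¹ * (p.1 - if p.2 = 0 then x else 0), p.2 - 1)
  left_inv p := by ext <;> simp [eq_neg_iff_add_eq_zero]
  right_inv p := by ext <;> simp [sub_eq_iff_eq_add]

/-- The action of the generator `b` on `ZMod m × ZMod k`. -/
def bsPermB (m k : ℕ) : Equiv.Perm (ZMod m × ZMod k) :=
  (Equiv.addRight 1).prodCongr (Equiv.refl _)

theorem bsPermB_pow_apply {m k : ℕ} (j : ℕ) (p : ZMod m × ZMod k) :
    (bsPermB m k ^ j) p = (p.1 + j, p.2) := by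
  induction j with
  | zero => simp
  | succ j ih =>
    rw [pow_succ', Equiv.Perm.mul_apply, ih]
    simp [bsPermB, add_assoc]

theorem bsPermA_pow_apply {m k : ℕ} (u : (ZMod m)ˣ) (x : ZMod m) {t : ℕ} (ht : t < k) :
    (bsPermA u x ^ t) ((0, 0) : ZMod m × ZMod k) = (0, (t : ZMod k)) := by
  induction t with
  | zero => simp
  | succ t ih =>
    rw [pow_succ', Equiv.Perm.mul_apply, ih (by omega)]
    have h1 : ((t : ℕ) : ZMod k) ≠ -1 := by
      rw [Ne, eq_neg_iff_add_eq_zero, ← Nat.cast_succ, ZMod.natCast_eq_zero_iff]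
      exact Nat.not_dvd_of_pos_of_lt (by omega) ht
    simp [bsPermA, h1]

namespace PresentedGroup

theorem isBSGenerators (d : ℕ) :
    IsBSGenerators (PresentedGroup.of 0 : PresentedGroup (bsRels d)) (PresentedGroup.of 1) d := by
  constructor
  · have h := PresentedGroup.one_of_mem (rels := bsRels d) (Set.mem_singleton _)
    rw [map_mul, map_mul, map_mul, map_inv, map_zpow, zpow_neg, zpow_natCast,
      mul_inv_eq_one] at h
    exact h
  · rw [← PresentedGroup.closure_range_of (bsRels d)]
    congr 1
    ext g
    simp [Fin.exists_fin_two, eq_comm]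

theorem exists_hasBSType {d m k : ℕ} (hm : 0 < m) (hk : 0 < k) (hmd : m.Coprime d) (x : ℤ) :
    ∃ H : Subgroup (PresentedGroup (bsRels d)),
      HasBSType (PresentedGroup.of 0) (PresentedGroup.of 1) m k x H := by
  have : NeZero m := ⟨hm.ne'⟩
  have : NeZero k := ⟨hk.ne'⟩
  let u : (ZMod m)ˣ := ZMod.unitOfCoprime d hmd.symm
  let f : Fin 2 → Equiv.Perm (ZMod m × ZMod k) := ![bsPermA u x, bsPermB m k]
  have hrel : ∀ r ∈ bsRels d, FreeGroup.lift f r = 1 := by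
    rintro _ rfl
    simp only [map_mul, map_inv, map_pow, FreeGroup.lift_apply_of, zpow_neg, zpow_natCast]
    rw [mul_inv_eq_one, mul_inv_eq_iff_eq_mul]
    ext1 p
    change bsPermA u x (bsPermB m k p) = (bsPermB m k ^ d) (bsPermA u x p)
    rw [bsPermB_pow_apply]
    ext <;> simp [bsPermA, bsPermB, u]
    ring
  let φ := PresentedGroup.toGroup hrel
  let _ : MulAction (PresentedGroup (bsRels d)) (ZMod m × ZMod k) := MulAction.compHom _ φ
  have hsmul (g : PresentedGroup (bsRels d)) (p : ZMod m × ZMod k) : g • p = φ g p := rfl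
  have ha : φ (PresentedGroup.of 0) = bsPermA u x := PresentedGroup.toGroup.of hrel
  have hb : φ (PresentedGroup.of 1) = bsPermB m k := PresentedGroup.toGroup.of hrel
  refine ⟨MulAction.stabilizer _ ((0, 0) : ZMod m × ZMod k), ?_, ?_, ?_⟩
  · rw [MulAction.index_stabilizer]
    have : MulAction.orbit (PresentedGroup (bsRels d)) ((0, 0) : ZMod m × ZMod k) =
        Set.univ := by
      refine Set.eq_univ_of_forall fun p => ?_
      refine ⟨PresentedGroup.of 1 ^ p.1.val * PresentedGroup.of 0 ^ p.2.val, ?_⟩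
      simp only [hsmul]
      rw [map_mul, map_pow, map_pow, ha, hb, Equiv.Perm.mul_apply,
        bsPermA_pow_apply u _ p.2.val_lt, bsPermB_pow_apply]
      simp
    rw [this, Set.ncard_univ]
    simp
  · rw [MulAction.mem_stabilizer_iff, hsmul, map_pow, hb, bsPermB_pow_apply]
    simp
  · obtain ⟨l, rfl⟩ : ∃ l, k = l + 1 := ⟨k - 1, by omega⟩
    have hx : (x : ZMod m) = ((x : ZMod m).val : ZMod m) := by simp
    rw [MulAction.mem_stabilizer_iff, mul_smul, zpow_neg, inv_smul_eq_iff, hsmul, hsmul,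
      map_pow, map_zpow, ha, hb, pow_succ', Equiv.Perm.mul_apply,
      bsPermA_pow_apply u _ (Nat.lt_succ_self l)]
    have h1 : (l : ZMod (l + 1)) = -1 := by
      rw [eq_neg_iff_add_eq_zero, ← Nat.cast_succ, ZMod.natCast_self]
    have h2 : (bsPermB m (l + 1) ^ x) (0, 0) = ((x : ZMod m), 0) := by
      cases x with
      | ofNat j => simp [bsPermB_pow_apply]
      | negSucc j =>
        rw [zpow_negSucc, Equiv.Perm.inv_eq_iff_eq, bsPermB_pow_apply]
        simp
    rw [h2]
    simp [bsPermA, h1]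

theorem hasBSType_of_finiteIndex {d : ℕ} (H : Subgroup (PresentedGroup (bsRels d)))
    [H.FiniteIndex] : ∃ (m k : ℕ) (x : ℤ), 0 < m ∧ 0 < k ∧ m.Coprime d ∧
      HasBSType (PresentedGroup.of 0) (PresentedGroup.of 1) m k x H := by
  have hG := isBSGenerators d
  set a : PresentedGroup (bsRels d) := PresentedGroup.of 0
  set b : PresentedGroup (bsRels d) := PresentedGroup.of 1
  set q : PresentedGroup (bsRels d) ⧸ H := ((1 : PresentedGroup (bsRels d)) : _ ⧸ H) with hq
  have hmem (j : ℕ) : b ^ j ∈ H ↔ MulAction.period b q ∣ j := by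
    rw [← MulAction.pow_smul_eq_iff_period_dvd, hq, MulAction.Quotient.smul_coe, eq_comm,
      QuotientGroup.eq]
    simp
  obtain ⟨N, hN, -, haN⟩ := H.exists_pow_mem_of_index_ne_zero
    Subgroup.FiniteIndex.index_ne_zero a
  obtain ⟨M, hM, -, hbM⟩ := H.exists_pow_mem_of_index_ne_zero
    Subgroup.FiniteIndex.index_ne_zero b
  have hm : 0 < MulAction.period b q := Nat.pos_of_dvd_of_pos ((hmem M).mp hbM) hM
  have hex : ∃ k : ℕ, 0 < k ∧ ∃ x : ℤ, b ^ (-x) * a ^ k ∈ H := ⟨N, hN, 0, by simpa using haN⟩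
  classical
  obtain ⟨hk, x, hx⟩ := Nat.find_spec hex
  refine ⟨MulAction.period b q, Nat.find hex, x, hm, hk, hG.coprime_period q, ?_⟩
  obtain ⟨S, hS⟩ := exists_hasBSType hm hk (hG.coprime_period q) x
  have := hS.finiteIndex hm hk
  have hle : S ≤ H := by
    have key := hG.index_le (K := H ⊓ S) hm hk ⟨(hmem _).mpr dvd_rfl, hS.pow_mem⟩ ⟨hx, hS.mem⟩
    rw [← Subgroup.eq_of_le_of_index_le inf_le_right (key.trans_eq hS.index_eq.symm)]
    exact inf_le_left
  have hge : H ≤ S := by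
    intro g hg
    obtain ⟨s, hs, t, ht, y, hy, rfl⟩ := hG.exists_eq_mul hm hk hS.pow_mem hS.mem g
    rw [Subgroup.mul_mem_cancel_right _ (hle hy)] at hg
    have ht0 : t = 0 := by
      by_contra h0
      exact Nat.find_min hex ht ⟨Nat.pos_of_ne_zero h0, -s, by simpa using hg⟩
    subst ht0
    rw [pow_zero, mul_one, hmem] at hg
    have hs0 : s = 0 := Nat.eq_zero_of_dvd_of_lt hg hs
    subst hs0
    simpa using hy
  exact ⟨le_antisymm hge hle ▸ hS.index_eq, (hmem _).mpr dvd_rfl, hx⟩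

end PresentedGroup

theorem orderOf_natCast_zmod_dvd_iff {d m k : ℕ} :
    orderOf (d : ZMod m) ∣ k ↔ (m : ℤ) ∣ (d : ℤ) ^ k - 1 := by
  rw [orderOf_dvd_iff_pow_eq_one, ← sub_eq_zero, ← ZMod.intCast_zmod_eq_zero_iff_dvd]
  push_cast
  rfl

/-- For `m ∣ n`, the numbers `i` such that the degree of `(m, i)` divides `n` are the multiples
of `bsStep d n m`. -/
def bsStep (d n m : ℕ) : ℕ :=
  m / Int.gcd m ((d : ℤ) ^ (n / m) - 1)

theorem bsStep_mul_gcd (d n m : ℕ) :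
    bsStep d n m * Int.gcd m ((d : ℤ) ^ (n / m) - 1) = m :=
  Nat.div_mul_cancel (Int.natCast_dvd_natCast.mp (Int.gcd_dvd_left _ _))

theorem Int.dvd_mul_iff_div_gcd_dvd {m D : ℤ} (hm : m ≠ 0) (i : ℤ) :
    m ∣ i * D ↔ m / Int.gcd m D ∣ i := by
  have hg : (Int.gcd m D : ℤ) ≠ 0 := by
    exact_mod_cast (Int.gcd_pos_of_ne_zero_left D hm).ne'
  obtain ⟨c, hc⟩ := Int.gcd_dvd_left m D
  obtain ⟨e, he⟩ := Int.gcd_dvd_right m D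
  have hce : IsCoprime c e := by
    obtain ⟨x, y, hxy⟩ := Int.gcd_dvd_iff.mp (dvd_refl (Int.gcd m D))
    refine ⟨x, y, mul_left_cancel₀ hg ?_⟩
    linear_combination -hxy - x * hc - y * he
  set g : ℤ := (Int.gcd m D : ℤ)
  have h1 : m / g = c := by rw [hc, Int.mul_ediv_cancel_left _ hg]
  rw [h1, hc, he, mul_left_comm, mul_dvd_mul_iff_left hg]
  exact ⟨hce.dvd_of_dvd_mul_right, fun h => h.mul_right e⟩

theorem bsDeg_dvd_iff {d n m i : ℕ} (hn : 0 < n) (hm : 0 < m) :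
    bsDeg d m i ∣ n ↔ m ∣ n ∧ bsStep d n m ∣ i := by
  have key (hmn : m ∣ n) : bsDeg d m i ∣ n ↔ bsStep d n m ∣ i := by
    obtain ⟨k, rfl⟩ := hmn
    have hm' : (m : ℤ) ≠ 0 := by positivity
    by_cases hD : (d : ℤ) ^ k - 1 = 0
    · rw [bsDeg, bsStep, Nat.mul_div_cancel_left _ hm, Nat.mul_dvd_mul_iff_left hm,
        orderOf_natCast_zmod_dvd_iff, hD]
      simp [Nat.div_self hm]
    · have h1 := Int.dvd_mul_iff_div_gcd_dvd hm' i (D := (d : ℤ) ^ k - 1)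
      have h2 := Int.dvd_mul_iff_div_gcd_dvd hm' ((d : ℤ) ^ k - 1) (D := i)
      rw [bsDeg, bsStep, Nat.mul_div_cancel_left _ hm, Nat.mul_dvd_mul_iff_left hm,
        orderOf_natCast_zmod_dvd_iff, ← Int.natCast_dvd_natCast, Int.natCast_div,
        Int.natCast_div, ← h1, mul_comm, h2, Int.gcd_natCast_natCast]
  constructor
  · intro h
    have hmn : m ∣ n := (Dvd.intro _ rfl).trans h
    exact ⟨hmn, (key hmn).mp h⟩
  · rintro ⟨hmn, h⟩
    exact (key hmn).mpr h

theorem bsStep_mul_modEq_iff {d n m u v : ℕ} (hm : 0 < m) (j : ℕ) :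
    bsStep d n m * v ≡ bsStep d n m * u * d ^ j [MOD m] ↔
      ∃ r : ℤ, (u : ℤ) * d ^ j + r * (d ^ (n / m) - 1) ≡ v [ZMOD m] := by
  have hcg := bsStep_mul_gcd d n m
  set c := bsStep d n m
  set D : ℤ := (d : ℤ) ^ (n / m) - 1
  have hc : (c : ℤ) ≠ 0 := by
    intro h
    have : c = 0 := by exact_mod_cast h
    rw [this] at hcg
    omega
  have h1 : c * v ≡ c * u * d ^ j [MOD m] ↔ (Int.gcd m D : ℤ) ∣ (u : ℤ) * d ^ j - v := by
    rw [← Int.natCast_modEq_iff, Int.modEq_iff_dvd]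
    have h2 : (c : ℤ) * Int.gcd m D = m := by exact_mod_cast hcg
    have h3 : ((c * u * d ^ j : ℕ) : ℤ) - (c * v : ℕ) = c * (u * d ^ j - v) := by
      push_cast
      ring
    rw [h3, ← mul_dvd_mul_iff_left hc (b := (Int.gcd m D : ℤ)), h2]
  rw [h1]
  constructor
  · rintro ⟨e, he⟩
    obtain ⟨x, y, hxy⟩ := Int.gcd_dvd_iff.mp (dvd_refl (Int.gcd m D))
    refine ⟨-(y * e), Int.modEq_iff_dvd.mpr ⟨-(x * e), ?_⟩⟩
    linear_combination -he - e * hxy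
  · rintro ⟨r, hr⟩
    obtain ⟨x, hx⟩ := hr.dvd
    have h4 : (u : ℤ) * d ^ j - v = m * (-x) + D * (-r) := by linear_combination -hx
    rw [h4]
    exact dvd_add ((Int.gcd_dvd_left _ _).mul_right _) ((Int.gcd_dvd_right _ _).mul_right _)

theorem Nat.card_quot_congr {α β : Type*} {r : α → α → Prop} {s : β → β → Prop}
    (hs : Equivalence s) (f : α → β) (hr : ∀ p q, r p q ↔ s (f p) (f q))
    (hf : ∀ y, ∃ p, s (f p) y) : Nat.card (Quot r) = Nat.card (Quot s) := by
  refine Nat.card_congr (Equiv.ofBijective (Quot.map f fun p q => (hr p q).mp) ⟨?_, ?_⟩)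
  · rintro ⟨p⟩ ⟨q⟩ h
    exact Quot.sound ((hr p q).mpr (hs.eqvGen_iff.mp (Quot.eqvGen_exact h)))
  · rintro ⟨y⟩
    obtain ⟨p, hp⟩ := hf y
    exact ⟨Quot.mk _ p, Quot.sound hp⟩

theorem equivalence_conj {G : Type*} [Group G] (n : ℕ) :
    Equivalence fun H K : {H : Subgroup G // H.index = n} =>
      ∃ g, K.1 = Subgroup.map (MulAut.conj g).toMonoidHom H.1 where
  refl H := ⟨1, by ext; simp⟩
  symm := by
    rintro H K ⟨g, h⟩
    refine ⟨g⁻¹, ?_⟩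
    ext y
    rw [mem_map_conj_iff, h, mem_map_conj_iff]
    simp [mul_assoc]
  trans := by
    rintro H K L ⟨g, h⟩ ⟨g', h'⟩
    refine ⟨g' * g, ?_⟩
    ext y
    rw [h', mem_map_conj_iff, h, mem_map_conj_iff, mem_map_conj_iff]
    simp [mul_assoc]

theorem stmt_18 (d : ℕ) (hd : 2 ≤ d) (n : ℕ) (hn : 1 ≤ n) :
    Nat.card (Quot fun H K : {H : Subgroup (PresentedGroup (bsRels d)) // H.index = n} =>
        ∃ g, K.1 = Subgroup.map (MulAut.conj g).toMonoidHom H.1) =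
      Nat.card (Quot fun p q : {p : ℕ × ℕ //
            1 ≤ p.1 ∧ Nat.gcd p.1 d = 1 ∧ p.2 < p.1 ∧ bsDeg d p.1 p.2 ∣ n} =>
        p.1.1 = q.1.1 ∧ ∃ j : ℕ, p.1.2 ≡ q.1.2 * d ^ j [MOD p.1.1]) := by
  have hG := PresentedGroup.isBSGenerators d
  have hdata (p : {p : ℕ × ℕ //
      1 ≤ p.1 ∧ Nat.gcd p.1 d = 1 ∧ p.2 < p.1 ∧ bsDeg d p.1 p.2 ∣ n}) :
      0 < n / p.1.1 ∧ p.1.1 * (n / p.1.1) = n ∧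
        bsStep d n p.1.1 * (p.1.2 / bsStep d n p.1.1) = p.1.2 := by
    obtain ⟨⟨m, i⟩, hm, -, -, hdeg⟩ := p
    obtain ⟨hmn, hi⟩ := (bsDeg_dvd_iff hn hm).mp hdeg
    exact ⟨Nat.div_pos (Nat.le_of_dvd hn hmn) hm, Nat.mul_div_cancel' hmn,
      Nat.mul_div_cancel' hi⟩
  choose F hF using fun p : {p : ℕ × ℕ //
      1 ≤ p.1 ∧ Nat.gcd p.1 d = 1 ∧ p.2 < p.1 ∧ bsDeg d p.1 p.2 ∣ n} =>
    PresentedGroup.exists_hasBSType p.2.1 (hdata p).1 p.2.2.1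
      (p.1.2 / bsStep d n p.1.1 : ℕ)
  have hconj := equivalence_conj (G := PresentedGroup (bsRels d)) n
  symm
  refine Nat.card_quot_congr hconj
    (fun p => ⟨F p, (hF p).index_eq.trans (hdata p).2.1⟩) ?_ ?_
  · intro p q
    refine Iff.trans ?_ ⟨fun h => hconj.symm h, fun h => hconj.symm h⟩
    rw [(hF q).conj_iff hG q.2.1 (hdata q).1 p.2.1 (hdata p).1 (hF p)]
    obtain ⟨⟨m, i⟩, hp⟩ := p
    obtain ⟨⟨m', i'⟩, hq⟩ := q
    have hdp := (hdata ⟨⟨m, i⟩, hp⟩).2.2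
    have hdq := (hdata ⟨⟨m', i'⟩, hq⟩).2.2
    simp only at hdp hdq ⊢
    constructor
    · rintro ⟨rfl, j, hj⟩
      refine ⟨rfl, rfl, j, (bsStep_mul_modEq_iff hp.1 j).mp ?_⟩
      rwa [hdp, hdq]
    · rintro ⟨rfl, -, j, hj⟩
      refine ⟨rfl, j, ?_⟩
      have := (bsStep_mul_modEq_iff hp.1 j).mpr hj
      rwa [hdp, hdq] at this
  · rintro ⟨H, hH⟩
    have : H.FiniteIndex := ⟨by omega⟩
    obtain ⟨m, k, x, hm, hk, hmd, hT⟩ := PresentedGroup.hasBSType_of_finiteIndex H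
    have hmk : m * k = n := hT.index_eq.symm.trans hH
    have hnm : n / m = k := by rw [← hmk, Nat.mul_div_cancel_left _ hm]
    have hcg := bsStep_mul_gcd d n m
    have hc : 0 < bsStep d n m := Nat.pos_of_mul_pos_right (hcg.symm ▸ hm)
    have hg : 0 < Int.gcd m ((d : ℤ) ^ (n / m) - 1) := Nat.pos_of_mul_pos_left (hcg.symm ▸ hm)
    set g := Int.gcd m ((d : ℤ) ^ (n / m) - 1)
    have hg' : (0 : ℤ) < g := by exact_mod_cast hg
    obtain ⟨u, hu⟩ := Int.eq_ofNat_of_zero_le (Int.emod_nonneg x hg'.ne')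
    have hug := Int.emod_lt_of_pos x hg'
    let p : {p : ℕ × ℕ // 1 ≤ p.1 ∧ Nat.gcd p.1 d = 1 ∧ p.2 < p.1 ∧ bsDeg d p.1 p.2 ∣ n} :=
      ⟨(m, bsStep d n m * u), hm, hmd, by
        conv_rhs => rw [← hcg]
        exact Nat.mul_lt_mul_of_pos_left (by omega) hc,
        (bsDeg_dvd_iff hn hm).mpr ⟨⟨k, hmk.symm⟩, dvd_mul_right _ _⟩⟩
    refine ⟨p, ((hF p).conj_iff hG hm (hdata p).1 hm hk hT).mpr ⟨rfl, hnm, 0, ?_⟩⟩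
    obtain ⟨y, z, hyz⟩ := Int.gcd_dvd_iff.mp (dvd_refl g)
    have hx := Int.emod_add_mul_ediv x g
    refine ⟨x / g * z, Int.modEq_iff_dvd.mpr ⟨x / g * y, ?_⟩⟩
    have h1 : p.1.2 / bsStep d n p.1.1 = u := Nat.mul_div_cancel_left _ hc
    rw [h1]
    change x - ((u : ℤ) * d ^ 0 + x / g * z * (d ^ (n / m) - 1)) = m * (x / g * y)
    rw [hu] at hx
    linear_combination -hx + (x / g) * hyz
end
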